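/- Fix λ ∈ ℝ \ {0} and A > 0. Let q and q̃ be admissible potentials on (0,A), each equipped with a normalized fundamental system, with associated characteristic functions Δ, Δ̃ and functions δ, δ̃. If δ(μ)·Δ̃(μ) = δ̃(μ)·Δ(μ) for all μ ∈ ℂ (equivalently, if the generalized Weyl–Titchmarsh functions M(μ²) = −δ(μ)/Δ(μ) and M̃(μ²) = −δ̃(μ)/Δ̃(μ) coincide away from their poles), then q(x) = q̃(x) for all x ∈ (0,A). -/

import Mathlib

open Filter MeasureTheory Topology

/-- `u` is a twice continuously differentiable solution of `−u'' + q u = −μ² u`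
on `(0,A)`. -/
def SolvesRadialODE (A : ℝ) (q : ℝ → ℂ) (μ : ℂ) (u : ℝ → ℂ) : Prop :=
  ∀ x ∈ Set.Ioo (0 : ℝ) A,
    DifferentiableAt ℝ u x ∧ DifferentiableAt ℝ (deriv u) x ∧
    ContinuousAt (deriv (deriv u)) x ∧
    -(deriv (deriv u) x) + q x * u x = -μ ^ 2 * u x

/-- An admissible potential on `(0,A)`: continuous, with regular singularities
`(−λ²−1/4)/x²` at `x = 0` and `(−λ²−1/4)/(A−x)²` at `x = A` and integrable
perturbations. -/
def IsAdmissible (lam A : ℝ) (q : ℝ → ℂ) : Prop :=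
  ContinuousOn q (Set.Ioo 0 A) ∧
  (∃ q₀ : ℝ → ℂ,
    (∀ x ∈ Set.Ioo (0 : ℝ) A,
      q x = (-(lam : ℂ) ^ 2 - 1/4) / (x : ℂ) ^ 2 + q₀ x) ∧
    IntegrableOn (fun t : ℝ => t * ‖q₀ t‖) (Set.Ioo 0 (A/2))) ∧
  (∃ q₁ : ℝ → ℂ,
    (∀ x ∈ Set.Ioo (0 : ℝ) A,
      q x = (-(lam : ℂ) ^ 2 - 1/4) / ((A : ℂ) - (x : ℂ)) ^ 2 + q₁ x) ∧
    IntegrableOn (fun t : ℝ => (A - t) * ‖q₁ t‖) (Set.Ioo (A/2) A))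

/-- A normalized fundamental system `(S₁₀, S₂₀, S₁₁)` for an admissible potential:
solutions of the radial ODE, entire and even in `μ`, with normalized asymptotics
`S₁₀ ∼ x^{1/2−iλ}`, `S₂₀ ∼ (1/(2iλ))x^{1/2+iλ}` at `x = 0` and
`S₁₁ ∼ (A−x)^{1/2−iλ}` at `x = A`. -/
def IsNormalizedFS (lam A : ℝ) (q : ℝ → ℂ) (S10 S20 S11 : ℝ → ℂ → ℂ) : Prop :=
  (∀ μ : ℂ, SolvesRadialODE A q μ (fun x => S10 x μ) ∧
            SolvesRadialODE A q μ (fun x => S20 x μ) ∧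
            SolvesRadialODE A q μ (fun x => S11 x μ)) ∧
  (∀ x ∈ Set.Ioo (0 : ℝ) A,
    (Differentiable ℂ (S10 x) ∧ ∀ μ : ℂ, S10 x μ = S10 x (-μ)) ∧
    (Differentiable ℂ (S20 x) ∧ ∀ μ : ℂ, S20 x μ = S20 x (-μ)) ∧
    (Differentiable ℂ (S11 x) ∧ ∀ μ : ℂ, S11 x μ = S11 x (-μ))) ∧
  (∀ μ : ℂ,
    Tendsto (fun x : ℝ => S10 x μ * (x : ℂ) ^ ((-1/2 : ℂ) + Complex.I * lam))
      (𝓝[>] 0) (𝓝 1) ∧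
    Tendsto (fun x : ℝ =>
        2 * Complex.I * lam * S20 x μ * (x : ℂ) ^ ((-1/2 : ℂ) - Complex.I * lam))
      (𝓝[>] 0) (𝓝 1) ∧
    Tendsto (fun x : ℝ =>
        S11 x μ * ((A : ℂ) - (x : ℂ)) ^ ((-1/2 : ℂ) + Complex.I * lam))
      (𝓝[<] A) (𝓝 1))

/-- The characteristic function `Δ(μ) = W(S₁₁, S₁₀)`, evaluated at the sample point
`x = A/2` (the Wronskian is independent of `x ∈ (0,A)`). -/
noncomputable def charFun (A : ℝ) (S10 S11 : ℝ → ℂ → ℂ) (μ : ℂ) : ℂ :=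
  S11 (A/2) μ * deriv (fun x => S10 x μ) (A/2) -
    deriv (fun x => S11 x μ) (A/2) * S10 (A/2) μ

/-- The function `δ(μ) = W(S₁₁, S₂₀)`, evaluated at the sample point `x = A/2`
(the Wronskian is independent of `x ∈ (0,A)`). -/
noncomputable def deltaFun (A : ℝ) (S20 S11 : ℝ → ℂ → ℂ) (μ : ℂ) : ℂ :=
  S11 (A/2) μ * deriv (fun x => S20 x μ) (A/2) -
    deriv (fun x => S11 x μ) (A/2) * S20 (A/2) μ

/-- The Euler solution `x ^ (1/2 + iλ)`. -/
noncomputable def eulerSol (lam : ℝ) (x : ℝ) : ℂ := (x : ℂ) ^ ((1/2 : ℂ) + Complex.I * lam)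

/-- The coefficient of `u` along the Euler solution `x ^ (1/2 + iλ)`, up to the factor `2iλ`;
`u₁` plays the role of the derivative of `u`. -/
noncomputable def eulerCoeff (lam : ℝ) (u u₁ : ℝ → ℂ) (x : ℝ) : ℂ :=
  (x * u₁ x - ((1/2 : ℂ) - Complex.I * lam) * u x) / eulerSol lam x

/-- `u` solves `u'' = (q + μ²) u` on `(0,A)` with `q = (−λ²−1/4)/x² + q₀`, where `u₁` is the derivative of `u`. -/
def IsEulerSol (lam A : ℝ) (q₀ : ℝ → ℂ) (μ : ℂ) (u u₁ : ℝ → ℂ) : Prop :=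
  ∀ x ∈ Set.Ioo (0 : ℝ) A, HasDerivAt u (u₁ x) x ∧
    HasDerivAt u₁ (((-(lam : ℂ) ^ 2 - 1/4) / (x : ℂ) ^ 2 + q₀ x + μ ^ 2) * u x) x

/-- `Γ` is the primitive of `t ‖q₀ t‖` vanishing at `0`. -/
def IsWeightPrimitive (A : ℝ) (q₀ : ℝ → ℂ) (Γ : ℝ → ℝ) : Prop :=
  (∀ x ∈ Set.Ioo (0 : ℝ) A, HasDerivAt Γ (x * ‖q₀ x‖) x) ∧ Tendsto Γ (𝓝[>] 0) (𝓝 0)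

/-- `u ∼ x ^ (1/2 − iλ)` at `0`. -/
def IsNormalizedAtZero (lam : ℝ) (u : ℝ → ℂ) : Prop :=
  Tendsto (fun x => u x / eulerSol (-lam) x) (𝓝[>] 0) (𝓝 1)

lemma le_mul_exp_of_deriv_le {E E' g g' : ℝ → ℝ} {y x : ℝ} (hyx : y ≤ x)
    (hE : ∀ t ∈ Set.Icc y x, HasDerivAt E (E' t) t)
    (hg : ∀ t ∈ Set.Icc y x, HasDerivAt g (g' t) t)
    (h : ∀ t ∈ Set.Icc y x, E' t ≤ g' t * E t) :
    E x ≤ E y * Real.exp (g x - g y) := by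
  have hd : ∀ t ∈ Set.Icc y x, HasDerivAt (fun t => E t * Real.exp (-g t))
      (E' t * Real.exp (-g t) + E t * (Real.exp (-g t) * -g' t)) t := fun t ht =>
    (hE t ht).mul (hg t ht).neg.exp
  have ha : AntitoneOn (fun t => E t * Real.exp (-g t)) (Set.Icc y x) := by
    refine antitoneOn_of_hasDerivWithinAt_nonpos (convex_Icc y x)
      (fun t ht => (hd t ht).continuousAt.continuousWithinAt)
      (fun t ht => (hd t (interior_subset ht)).hasDerivWithinAt) fun t ht => ?_
    have h1 := h t (interior_subset ht)
    have h2 := Real.exp_pos (-g t)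
    nlinarith
  have h3 := ha (Set.left_mem_Icc.2 hyx) (Set.right_mem_Icc.2 hyx) hyx
  simp only at h3
  calc E x = (E x * Real.exp (-g x)) * Real.exp (g x) := by
        rw [mul_assoc, ← Real.exp_add]; simp
    _ ≤ (E y * Real.exp (-g y)) * Real.exp (g x) := by gcongr
    _ = _ := by rw [mul_assoc, ← Real.exp_add]; ring_nf

lemma norm_sub_le_of_norm_deriv_le {V : Type*} [NormedAddCommGroup V] [NormedSpace ℝ V]
    {f f' : ℝ → V} {g g' : ℝ → ℝ} {y x : ℝ} (hyx : y ≤ x)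
    (hf : ∀ t ∈ Set.Icc y x, HasDerivAt f (f' t) t)
    (hg : ∀ t ∈ Set.Icc y x, HasDerivAt g (g' t) t)
    (h : ∀ t ∈ Set.Icc y x, ‖f' t‖ ≤ g' t) :
    ‖f x - f y‖ ≤ g x - g y := by
  refine image_norm_le_of_norm_deriv_right_le_deriv_boundary' (f := fun t => f t - f y)
    (f' := f') (B := fun t => g t - g y) (B' := g') (a := y) (b := x)
    (fun t ht => ((hf t ht).sub_const _).continuousAt.continuousWithinAt)
    (fun t ht => ((hf t ⟨ht.1, ht.2.le⟩).sub_const _).hasDerivWithinAt) (by simp)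
    (fun t ht => ((hg t ht).sub_const _).continuousAt.continuousWithinAt)
    (fun t ht => ((hg t ⟨ht.1, ht.2.le⟩).sub_const _).hasDerivWithinAt)
    (fun t ht => h t ⟨ht.1, ht.2.le⟩) (Set.right_mem_Icc.2 hyx)

section EulerSol

variable {lam x : ℝ}

lemma eulerSol_ne_zero (hx : 0 < x) : eulerSol lam x ≠ 0 := by
  rw [eulerSol, Complex.cpow_ne_zero_iff]
  left; exact_mod_cast hx.ne'

lemma norm_eulerSol (hx : 0 < x) : ‖eulerSol lam x‖ = √x := by
  rw [eulerSol, Complex.norm_cpow_eq_rpow_re_of_pos hx, Real.sqrt_eq_rpow]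
  simp

lemma norm_eulerSol_sq (hx : 0 < x) : ‖eulerSol lam x‖ ^ 2 = x := by
  rw [norm_eulerSol hx, Real.sq_sqrt hx.le]

lemma eulerSol_mul_neg (hx : 0 < x) : eulerSol lam x * eulerSol (-lam) x = x := by
  rw [eulerSol, eulerSol, ← Complex.cpow_add _ _ (by exact_mod_cast hx.ne')]
  push_cast
  ring_nf
  simp

lemma hasDerivAt_eulerSol (hx : 0 < x) :
    HasDerivAt (eulerSol lam) (((1/2 : ℂ) + Complex.I * lam) * eulerSol lam x / x) x := by
  have h := ((hasDerivAt_id (x : ℂ)).cpow_const (c := (1/2 : ℂ) + Complex.I * lam)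
    (Complex.ofReal_mem_slitPlane.2 hx)).comp_ofReal
  refine h.congr_deriv ?_
  simp only [id_eq]
  rw [Complex.cpow_sub _ _ (by exact_mod_cast hx.ne'), eulerSol]
  simp
  ring

end EulerSol

lemma two_lam_mul {lam x : ℝ} (hx : 0 < x) (u u₁ : ℝ → ℂ) :
    eulerSol lam x * eulerCoeff lam u u₁ x - eulerSol (-lam) x * eulerCoeff (-lam) u u₁ x =
      2 * Complex.I * lam * u x := by
  rw [eulerCoeff, eulerCoeff, mul_div_cancel₀ _ (eulerSol_ne_zero hx),
    mul_div_cancel₀ _ (eulerSol_ne_zero hx)]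
  push_cast
  ring

lemma IsEulerSol.neg {lam A : ℝ} {q₀ : ℝ → ℂ} {μ : ℂ} {u u₁ : ℝ → ℂ}
    (h : IsEulerSol lam A q₀ μ u u₁) : IsEulerSol (-lam) A q₀ μ u u₁ := by
  simpa [IsEulerSol] using h

lemma IsEulerSol.hasDerivAt_eulerCoeff {lam A : ℝ} {q₀ : ℝ → ℂ} {μ : ℂ} {u u₁ : ℝ → ℂ}
    (h : IsEulerSol lam A q₀ μ u u₁) {x : ℝ} (hx : x ∈ Set.Ioo 0 A) :
    HasDerivAt (eulerCoeff lam u u₁) (eulerSol (-lam) x * (q₀ x + μ ^ 2) * u x) x := by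
  obtain ⟨h1, h2⟩ := h x hx
  have h0 : HasDerivAt (fun y : ℝ => (y : ℂ)) 1 x := Complex.ofRealCLM.hasDerivAt
  have hne : eulerSol lam x ≠ 0 := eulerSol_ne_zero hx.1
  have hx0 : (x : ℂ) ≠ 0 := by exact_mod_cast hx.1.ne'
  have h3 := ((h0.mul h2).sub (h1.const_mul ((1/2 : ℂ) - Complex.I * lam))).div
    (hasDerivAt_eulerSol hx.1) hne
  refine h3.congr_deriv ?_
  have hm : eulerSol (-lam) x = x / eulerSol lam x := by
    rw [eq_div_iff hne, mul_comm, eulerSol_mul_neg hx.1]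
  rw [hm]
  simp only [Pi.sub_apply, Pi.mul_apply]
  field_simp
  ring_nf
  simp only [Complex.I_sq]
  ring

lemma norm_le_eulerCoeff {lam x : ℝ} (hx : 0 < x) (u u₁ : ℝ → ℂ) :
    2 * |lam| * ‖u x‖ ≤ √x * (‖eulerCoeff lam u u₁ x‖ + ‖eulerCoeff (-lam) u u₁ x‖) := by
  have h := congrArg norm (two_lam_mul (lam := lam) hx u u₁)
  have h2 : ‖2 * Complex.I * lam * u x‖ = 2 * |lam| * ‖u x‖ := by simp
  rw [← h2, ← h]
  refine (norm_sub_le _ _).trans ?_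
  rw [norm_mul, norm_mul, norm_eulerSol hx, norm_eulerSol hx]
  exact (mul_add _ _ _).ge

/-- The squared size of the pair of Euler coefficients. -/
noncomputable def eulerEnergy (lam : ℝ) (u u₁ : ℝ → ℂ) (x : ℝ) : ℝ :=
  ‖eulerCoeff lam u u₁ x‖ ^ 2 + ‖eulerCoeff (-lam) u u₁ x‖ ^ 2

lemma norm_sq_le_eulerEnergy {lam x : ℝ} (hx : 0 < x) (u u₁ : ℝ → ℂ) :
    2 * lam ^ 2 * ‖u x‖ ^ 2 ≤ x * eulerEnergy lam u u₁ x := by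
  have h := norm_le_eulerCoeff (lam := lam) hx u u₁
  have h2 := mul_self_le_mul_self (by positivity) h
  have h3 : √x * √x = x := Real.mul_self_sqrt hx.le
  rw [eulerEnergy]
  set a := ‖eulerCoeff lam u u₁ x‖
  set b := ‖eulerCoeff (-lam) u u₁ x‖
  have h4 : (√x * (a + b)) * (√x * (a + b)) = x * (a + b) ^ 2 := by
    calc _ = (√x * √x) * (a + b) ^ 2 := by ring
      _ = _ := by rw [h3]
  have h5 : (2 * |lam| * ‖u x‖) * (2 * |lam| * ‖u x‖) = 4 * lam ^ 2 * ‖u x‖ ^ 2 := by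
    rw [← sq_abs lam]; ring
  rw [h4, h5] at h2
  nlinarith [mul_nonneg hx.le (sq_nonneg (a - b))]

lemma IsEulerSol.hasDerivAt_eulerEnergy {lam A : ℝ} (hlam : lam ≠ 0) {q₀ : ℝ → ℂ} {μ : ℂ}
    {u u₁ : ℝ → ℂ} (h : IsEulerSol lam A q₀ μ u u₁) {x : ℝ} (hx : x ∈ Set.Ioo 0 A) :
    ∃ E', HasDerivAt (eulerEnergy lam u u₁) E' x ∧
      |E'| ≤ 2 / |lam| * (x * ‖q₀ x‖ + ‖μ‖ ^ 2 * x) * eulerEnergy lam u u₁ x := by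
  have ha := h.hasDerivAt_eulerCoeff hx
  have hb := h.neg.hasDerivAt_eulerCoeff hx
  rw [neg_neg] at hb
  refine ⟨_, ha.norm_sq.add hb.norm_sq, ?_⟩
  have hl : 0 < |lam| := abs_pos.2 hlam
  have hu := norm_le_eulerCoeff (lam := lam) hx.1 u u₁
  set a := eulerCoeff lam u u₁ x with hadef
  set b := eulerCoeff (-lam) u u₁ x with hbdef
  have hq : ‖q₀ x + μ ^ 2‖ ≤ ‖q₀ x‖ + ‖μ‖ ^ 2 := (norm_add_le _ _).trans (by simp)
  have h1 : ∀ l : ℝ, ‖eulerSol l x * (q₀ x + μ ^ 2) * u x‖ ≤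
      √x * (‖q₀ x‖ + ‖μ‖ ^ 2) * ‖u x‖ := fun l => by
    rw [norm_mul, norm_mul, norm_eulerSol hx.1]; gcongr
  have h2 : ∀ (z : ℂ) (l : ℝ), |inner ℝ z (eulerSol l x * (q₀ x + μ ^ 2) * u x)| ≤
      ‖z‖ * (√x * (‖q₀ x‖ + ‖μ‖ ^ 2) * ‖u x‖) := fun z l =>
    (abs_real_inner_le_norm _ _).trans (by gcongr; exact h1 l)
  have h3 : √x * √x = x := Real.mul_self_sqrt hx.1.le
  have h4 : 2 * (‖a‖ + ‖b‖) * (√x * (‖q₀ x‖ + ‖μ‖ ^ 2) * ‖u x‖) ≤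
      2 / |lam| * (x * ‖q₀ x‖ + ‖μ‖ ^ 2 * x) * (‖a‖ ^ 2 + ‖b‖ ^ 2) := by
    rw [div_mul_eq_mul_div, div_mul_eq_mul_div, le_div_iff₀ hl]
    calc _ = (‖a‖ + ‖b‖) * √x * (‖q₀ x‖ + ‖μ‖ ^ 2) * (2 * |lam| * ‖u x‖) := by ring
      _ ≤ (‖a‖ + ‖b‖) * √x * (‖q₀ x‖ + ‖μ‖ ^ 2) * (√x * (‖a‖ + ‖b‖)) := by gcongr
      _ = (√x * √x) * (‖q₀ x‖ + ‖μ‖ ^ 2) * (‖a‖ + ‖b‖) ^ 2 := by ring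
      _ = x * (‖q₀ x‖ + ‖μ‖ ^ 2) * (‖a‖ + ‖b‖) ^ 2 := by rw [h3]
      _ ≤ x * (‖q₀ x‖ + ‖μ‖ ^ 2) * (2 * (‖a‖ ^ 2 + ‖b‖ ^ 2)) := by
          have := hx.1.le
          gcongr
          nlinarith [sq_nonneg (‖a‖ - ‖b‖)]
      _ = _ := by ring
  have h5 := h2 a (-lam)
  have h6 := h2 b lam
  rw [eulerEnergy]
  refine (abs_add_le _ _).trans ?_
  rw [abs_mul, abs_mul, abs_two]
  linarith

lemma le_mul_exp_of_neg_le_deriv {E E' g g' : ℝ → ℝ} {y x : ℝ} (hyx : y ≤ x)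
    (hE : ∀ t ∈ Set.Icc y x, HasDerivAt E (E' t) t)
    (hg : ∀ t ∈ Set.Icc y x, HasDerivAt g (g' t) t)
    (h : ∀ t ∈ Set.Icc y x, -(g' t * E t) ≤ E' t) :
    E y ≤ E x * Real.exp (g x - g y) := by
  have hmem : ∀ t ∈ Set.Icc (-x) (-y), -t ∈ Set.Icc y x := fun t ht =>
    ⟨by linarith [ht.2], by linarith [ht.1]⟩
  have key := le_mul_exp_of_deriv_le (E := fun t => E (-t)) (E' := fun t => -E' (-t))
    (g := fun t => -g (-t)) (g' := fun t => g' (-t)) (neg_le_neg hyx)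
    (fun t ht => ((hE (-t) (hmem t ht)).comp t (hasDerivAt_neg t)).congr_deriv (by simp))
    (fun t ht => ((hg (-t) (hmem t ht)).comp t (hasDerivAt_neg t)).neg.congr_deriv (by simp))
    (fun t ht => by linarith [h (-t) (hmem t ht)])
  simp only [neg_neg] at key
  convert key using 3
  ring

namespace IsWeightPrimitive

variable {A : ℝ} {q₀ : ℝ → ℂ} {Γ : ℝ → ℝ}

lemma mono (h : IsWeightPrimitive A q₀ Γ) {y x : ℝ} (hy : 0 < y) (hyx : y ≤ x) (hx : x < A) :
    Γ y ≤ Γ x := by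
  have hd : ∀ t ∈ Set.Icc y x, HasDerivAt Γ (t * ‖q₀ t‖) t := fun t ht =>
    h.1 t ⟨hy.trans_le ht.1, ht.2.trans_lt hx⟩
  exact monotoneOn_of_hasDerivWithinAt_nonneg (convex_Icc y x)
    (fun t ht => (hd t ht).continuousAt.continuousWithinAt)
    (fun t ht => (hd t (interior_subset ht)).hasDerivWithinAt)
    (fun t ht => mul_nonneg (hy.le.trans (interior_subset ht).1) (norm_nonneg _))
    (Set.left_mem_Icc.2 hyx) (Set.right_mem_Icc.2 hyx) hyx

lemma nonneg (h : IsWeightPrimitive A q₀ Γ) {x : ℝ} (hx : x ∈ Set.Ioo 0 A) : 0 ≤ Γ x := by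
  refine le_of_tendsto h.2 ?_
  filter_upwards [Ioo_mem_nhdsGT hx.1] with y hy
  exact h.mono hy.1 hy.2.le hx.2

/-- The Gronwall exponent of the energy at spectral parameter `μ`. -/
lemma hasDerivAt_add_sq (h : IsWeightPrimitive A q₀ Γ) (μ : ℂ) {x : ℝ}
    (hx : x ∈ Set.Ioo 0 A) :
    HasDerivAt (fun t => Γ t + ‖μ‖ ^ 2 * t ^ 2 / 2) (x * ‖q₀ x‖ + ‖μ‖ ^ 2 * x) x := by
  refine ((h.1 x hx).add ((((hasDerivAt_pow 2 x).const_mul (‖μ‖ ^ 2))).div_const 2)).congr_deriv ?_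
  simp
  ring

lemma tendsto_add_sq (h : IsWeightPrimitive A q₀ Γ) (μ : ℂ) :
    Tendsto (fun t => Γ t + ‖μ‖ ^ 2 * t ^ 2 / 2) (𝓝[>] 0) (𝓝 0) := by
  have h2 : Tendsto (fun t : ℝ => ‖μ‖ ^ 2 * t ^ 2 / 2) (𝓝[>] 0) (𝓝 0) := by
    have : Continuous (fun t : ℝ => ‖μ‖ ^ 2 * t ^ 2 / 2) := by fun_prop
    simpa using this.continuousWithinAt (s := Set.Ioi 0) (x := 0) |>.tendsto
  simpa using h.2.add h2

end IsWeightPrimitive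

lemma tendsto_of_norm_sub_le {V : Type*} [NormedAddCommGroup V] [CompleteSpace V]
    {f : ℝ → V} {g : ℝ → ℝ} {B : ℝ} (hB : 0 < B) (hg : Tendsto g (𝓝[>] 0) (𝓝 0))
    (h : ∀ y x, 0 < y → y ≤ x → x < B → ‖f x - f y‖ ≤ g x - g y) :
    ∃ l, Tendsto f (𝓝[>] 0) (𝓝 l) := by
  rw [← cauchy_map_iff_exists_tendsto, Metric.cauchy_iff]
  refine ⟨inferInstance, fun ε hε => ?_⟩
  have hs : {x | |g x| < ε / 2} ∩ Set.Ioo 0 B ∈ 𝓝[>] (0 : ℝ) := by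
    refine inter_mem ?_ (Ioo_mem_nhdsGT hB)
    have := hg (Metric.ball_mem_nhds 0 (half_pos hε))
    simpa [Metric.ball, Set.preimage] using this
  refine ⟨_, image_mem_map hs, ?_⟩
  rintro _ ⟨x, ⟨hx1, hx2⟩, rfl⟩ _ ⟨y, ⟨hy1, hy2⟩, rfl⟩
  simp only [Set.mem_ofPred_eq, abs_lt] at hx1 hy1
  rw [dist_eq_norm]
  rcases le_total y x with hxy | hxy
  · linarith [h y x hy2.1 hxy hx2.2]
  · rw [norm_sub_rev]
    linarith [h x y hx2.1 hxy hy2.2]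

section Limits

variable {lam A : ℝ} {q₀ : ℝ → ℂ} {Γ : ℝ → ℝ} {μ : ℂ} {u u₁ : ℝ → ℂ}

lemma IsEulerSol.exists_tendsto_eulerCoeff (hlam : lam ≠ 0) (hA : 0 < A)
    (hΓ : IsWeightPrimitive A q₀ Γ) (h : IsEulerSol lam A q₀ μ u u₁) :
    ∃ l, Tendsto (eulerCoeff lam u u₁) (𝓝[>] 0) (𝓝 l) := by
  have hl : 0 < |lam| := abs_pos.2 hlam
  have hG := fun x (hx : x ∈ Set.Ioo 0 A) => hΓ.hasDerivAt_add_sq μ hx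
  set G : ℝ → ℝ := fun t => Γ t + ‖μ‖ ^ 2 * t ^ 2 / 2 with hGdef
  have hG0 : ∀ x ∈ Set.Ioo 0 A, 0 ≤ G x := fun x hx =>
    add_nonneg (hΓ.nonneg hx) (by positivity)
  choose! E' hE1 hE2 using fun x (hx : x ∈ Set.Ioo 0 A) => h.hasDerivAt_eulerEnergy hlam hx
  set M := eulerEnergy lam u u₁ (A / 2) * Real.exp (2 / |lam| * G (A / 2)) with hM
  have hB : A / 2 ∈ Set.Ioo 0 A := ⟨by linarith, by linarith⟩
  have hbound : ∀ y, 0 < y → y ≤ A / 2 → eulerEnergy lam u u₁ y ≤ M := fun y hy hyA => by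
    have hsub : ∀ t ∈ Set.Icc y (A / 2), t ∈ Set.Ioo 0 A := fun t ht =>
      ⟨hy.trans_le ht.1, ht.2.trans_lt hB.2⟩
    refine (le_mul_exp_of_neg_le_deriv (g := fun t => 2 / |lam| * G t) hyA
      (fun t ht => hE1 t (hsub t ht)) (fun t ht => (hG t (hsub t ht)).const_mul _)
      (fun t ht => (abs_le.1 (hE2 t (hsub t ht))).1)).trans ?_
    have h0 : 0 ≤ eulerEnergy lam u u₁ (A / 2) := by rw [eulerEnergy]; positivity
    have h1 := hG0 y (hsub y ⟨le_rfl, hyA⟩)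
    rw [hM]
    gcongr
    linarith [show 0 ≤ 2 / |lam| * G y by positivity]
  set C := (1 + M) / (2 * |lam|) with hC
  refine tendsto_of_norm_sub_le (g := fun t => C * G t) hB.1
    (by simpa using (hΓ.tendsto_add_sq μ).const_mul C) fun y x hy hyx hx => ?_
  have hsub : ∀ t ∈ Set.Icc y x, t ∈ Set.Ioo 0 A := fun t ht =>
    ⟨hy.trans_le ht.1, (ht.2.trans_lt hx).trans hB.2⟩
  refine norm_sub_le_of_norm_deriv_le hyx
    (fun t ht => h.hasDerivAt_eulerCoeff (hsub t ht))
    (fun t ht => (hG t (hsub t ht)).const_mul C) fun t ht => ?_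
  have ht0 := (hsub t ht).1
  have hE := hbound t ht0 (ht.2.trans hx.le)
  have hu := norm_le_eulerCoeff (lam := lam) ht0 u u₁
  rw [eulerEnergy] at hE
  set a := ‖eulerCoeff lam u u₁ t‖
  set b := ‖eulerCoeff (-lam) u u₁ t‖
  have hab : a + b ≤ 1 + M := by nlinarith [sq_nonneg (a - 1), sq_nonneg (b - 1)]
  have hq : ‖q₀ t + μ ^ 2‖ ≤ ‖q₀ t‖ + ‖μ‖ ^ 2 := (norm_add_le _ _).trans (by simp)
  rw [norm_mul, norm_mul, norm_eulerSol ht0, hC, div_mul_eq_mul_div,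
    le_div_iff₀ (by positivity)]
  calc √t * ‖q₀ t + μ ^ 2‖ * ‖u t‖ * (2 * |lam|)
      = √t * ‖q₀ t + μ ^ 2‖ * (2 * |lam| * ‖u t‖) := by ring
    _ ≤ √t * (‖q₀ t‖ + ‖μ‖ ^ 2) * (√t * (1 + M)) := by
        have hu' : 2 * |lam| * ‖u t‖ ≤ √t * (1 + M) := hu.trans (by gcongr)
        gcongr
    _ = (√t * √t) * (‖q₀ t‖ + ‖μ‖ ^ 2) * (1 + M) := by ring
    _ = _ := by rw [Real.mul_self_sqrt ht0.le]; ring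

/-- The oscillation of `x ^ (2iλ)` separates the two Euler coefficients of a normalized
solution. -/
lemma IsEulerSol.tendsto_eulerCoeff (hlam : lam ≠ 0) (hA : 0 < A)
    (hΓ : IsWeightPrimitive A q₀ Γ) (h : IsEulerSol lam A q₀ μ u u₁)
    (hn : IsNormalizedAtZero lam u) :
    Tendsto (eulerCoeff lam u u₁) (𝓝[>] 0) (𝓝 0) ∧
      Tendsto (eulerCoeff (-lam) u u₁) (𝓝[>] 0) (𝓝 (-(2 * Complex.I * lam))) := by
  obtain ⟨a, ha⟩ := h.exists_tendsto_eulerCoeff hlam hA hΓ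
  obtain ⟨b, hb⟩ := h.neg.exists_tendsto_eulerCoeff (neg_ne_zero.2 hlam) hA hΓ
  have hlim : Tendsto (fun x : ℝ => (x : ℂ) ^ (2 * Complex.I * lam) * eulerCoeff lam u u₁ x)
      (𝓝[>] 0) (𝓝 (2 * Complex.I * lam + b)) := by
    have h1 : Tendsto (fun x => 2 * Complex.I * lam * (u x / eulerSol (-lam) x) +
        eulerCoeff (-lam) u u₁ x) (𝓝[>] 0) (𝓝 (2 * Complex.I * lam * 1 + b)) :=
      (hn.const_mul _).add hb
    rw [mul_one] at h1
    refine h1.congr' ?_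
    filter_upwards [self_mem_nhdsWithin] with x hx
    have hne : eulerSol (-lam) x ≠ 0 := eulerSol_ne_zero hx
    have hx0 : (x : ℂ) ≠ 0 := by exact_mod_cast (Set.mem_Ioi.1 hx).ne'
    have h2 : (x : ℂ) ^ (2 * Complex.I * lam) = eulerSol lam x / eulerSol (-lam) x := by
      rw [eulerSol, eulerSol, ← Complex.cpow_sub _ _ hx0]
      congr 1
      push_cast
      ring
    rw [h2, ← mul_div_assoc, ← two_lam_mul hx u u₁]
    field_simp
    ring
  have hseq : ∀ c : ℝ, Tendsto (fun n : ℕ => Real.exp (-(c + n * (Real.pi / |lam|))))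
      atTop (𝓝[>] 0) := fun c => by
    refine tendsto_nhdsWithin_iff.2 ⟨?_, Eventually.of_forall fun n => Real.exp_pos _⟩
    refine Real.tendsto_exp_neg_atTop_nhds_zero.comp ?_
    exact tendsto_atTop_add_const_left _ _
      (tendsto_natCast_atTop_atTop.atTop_mul_const
        (div_pos Real.pi_pos (abs_pos.2 hlam)))
  have hpow : ∀ t : ℝ, ((Real.exp t : ℝ) : ℂ) ^ (2 * Complex.I * lam) =
      Complex.exp (t * (2 * Complex.I * lam)) := fun t => by
    rw [Complex.cpow_def_of_ne_zero (by exact_mod_cast (Real.exp_pos t).ne'),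
      ← Complex.ofReal_log (Real.exp_pos t).le, Real.log_exp]
  have hval : ∀ (c : ℝ) (n : ℕ), ((Real.exp (-(c + n * (Real.pi / |lam|))) : ℝ) : ℂ) ^
      (2 * Complex.I * lam) = Complex.exp (-(c * (2 * Complex.I * lam))) := fun c n => by
    rw [hpow, Complex.exp_eq_exp_iff_exists_int]
    have hl : (lam : ℂ) ≠ 0 := by exact_mod_cast hlam
    rcases abs_choice lam with h0 | h0
    · refine ⟨-n, ?_⟩
      rw [h0]; push_cast; field_simp; ring
    · refine ⟨n, ?_⟩
      rw [h0]; push_cast; field_simp; ring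
  have hc : ∀ c : ℝ, Complex.exp (-(c * (2 * Complex.I * lam))) * a = 2 * Complex.I * lam + b :=
    fun c => by
      refine tendsto_nhds_unique ?_ (hlim.comp (hseq c))
      simp only [Function.comp_def, hval]
      exact (ha.comp (hseq c)).const_mul _
  have hl : (lam : ℂ) ≠ 0 := by exact_mod_cast hlam
  have h0 := hc 0
  have h1 := hc (Real.pi / (2 * lam))
  have h2 : Complex.exp (-(((Real.pi / (2 * lam) : ℝ) : ℂ) * (2 * Complex.I * lam))) = -1 := by
    rw [show -(((Real.pi / (2 * lam) : ℝ) : ℂ) * (2 * Complex.I * lam)) =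
      -(Real.pi * Complex.I) by push_cast; field_simp]
    rw [Complex.exp_neg, Complex.exp_pi_mul_I]
    norm_num
  rw [h2] at h1
  simp only [Complex.ofReal_zero, zero_mul, neg_zero, Complex.exp_zero, one_mul] at h0
  have ha0 : a = 0 := by linear_combination (1 / 2 : ℂ) * h0 - (1 / 2 : ℂ) * h1
  have hb0 : b = -(2 * Complex.I * lam) := by
    rw [ha0] at h0
    linear_combination -h0
  exact ⟨ha0 ▸ ha, hb0 ▸ hb⟩

lemma IsEulerSol.tendsto_eulerEnergy (hlam : lam ≠ 0) (hA : 0 < A)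
    (hΓ : IsWeightPrimitive A q₀ Γ) (h : IsEulerSol lam A q₀ μ u u₁)
    (hn : IsNormalizedAtZero lam u) :
    Tendsto (eulerEnergy lam u u₁) (𝓝[>] 0) (𝓝 (4 * lam ^ 2)) := by
  obtain ⟨ha, hb⟩ := h.tendsto_eulerCoeff hlam hA hΓ hn
  have := (ha.norm.pow 2).add (hb.norm.pow 2)
  refine this.trans_eq ?_
  congr 1
  simp [mul_pow]
  norm_num

lemma IsEulerSol.eulerEnergy_le (hlam : lam ≠ 0)
    (hΓ : IsWeightPrimitive A q₀ Γ) (h : IsEulerSol lam A q₀ μ u u₁)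
    (hn : IsNormalizedAtZero lam u) {x : ℝ} (hx : x ∈ Set.Ioo 0 A) :
    eulerEnergy lam u u₁ x ≤
      4 * lam ^ 2 * Real.exp (2 / |lam| * (Γ x + ‖μ‖ ^ 2 * x ^ 2 / 2)) := by
  have hG := fun x (hx : x ∈ Set.Ioo 0 A) => hΓ.hasDerivAt_add_sq μ hx
  have hG0 := hΓ.tendsto_add_sq μ
  set G : ℝ → ℝ := fun t => Γ t + ‖μ‖ ^ 2 * t ^ 2 / 2 with hGdef
  choose! E' hE1 hE2 using fun x (hx : x ∈ Set.Ioo 0 A) => h.hasDerivAt_eulerEnergy hlam hx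
  have hlim : Tendsto (fun y => eulerEnergy lam u u₁ y *
      Real.exp (2 / |lam| * G x - 2 / |lam| * G y)) (𝓝[>] 0)
      (𝓝 (4 * lam ^ 2 * Real.exp (2 / |lam| * G x - 2 / |lam| * 0))) :=
    (h.tendsto_eulerEnergy hlam (hx.1.trans hx.2) hΓ hn).mul
      ((Real.continuous_exp.tendsto _).comp ((hG0.const_mul _).const_sub _))
  rw [mul_zero, sub_zero] at hlim
  refine ge_of_tendsto hlim ?_
  filter_upwards [Ioo_mem_nhdsGT hx.1] with y hy
  have hsub : ∀ t ∈ Set.Icc y x, t ∈ Set.Ioo 0 A := fun t ht =>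
    ⟨hy.1.trans_le ht.1, ht.2.trans_lt hx.2⟩
  exact le_mul_exp_of_deriv_le (g := fun t => 2 / |lam| * G t) hy.2.le
    (fun t ht => hE1 t (hsub t ht)) (fun t ht => (hG t (hsub t ht)).const_mul _)
    (fun t ht => (abs_le.1 (hE2 t (hsub t ht))).2)

end Limits

/-- The growing (`μ`) and decaying (`-μ`) components of a solution. -/
noncomputable def waveComponent (μ : ℂ) (u u₁ : ℝ → ℂ) (x : ℝ) : ℂ := u₁ x + μ * u x

/-- The squared size of the pair of wave components. -/
noncomputable def waveEnergy (μ : ℂ) (u u₁ : ℝ → ℂ) (x : ℝ) : ℝ :=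
  ‖waveComponent μ u u₁ x‖ ^ 2 + ‖waveComponent (-μ) u u₁ x‖ ^ 2

/-- A primitive dominating `‖q‖ / ρ` on `x ≥ K / ρ`. -/
noncomputable def potentialPrimitive (lam : ℝ) (Γ : ℝ → ℝ) (ρ K x : ℝ) : ℝ :=
  -((lam ^ 2 + 1/4) / ρ) * x⁻¹ + Γ x / K

section FarZone

variable {lam A : ℝ} {q₀ : ℝ → ℂ} {Γ : ℝ → ℝ} {μ : ℂ} {u u₁ : ℝ → ℂ}

lemma waveEnergy_eq (x : ℝ) :
    waveEnergy μ u u₁ x = 2 * (‖u₁ x‖ ^ 2 + ‖μ‖ ^ 2 * ‖u x‖ ^ 2) := by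
  have := parallelogram_law_with_norm ℝ (u₁ x) (μ * u x)
  rw [norm_mul] at this
  rw [waveEnergy, waveComponent, waveComponent, neg_mul, ← sub_eq_add_neg]
  linarith

lemma IsEulerSol.neg_param (h : IsEulerSol lam A q₀ μ u u₁) :
    IsEulerSol lam A q₀ (-μ) u u₁ := by
  simpa [IsEulerSol] using h

lemma IsEulerSol.hasDerivAt_waveComponent (h : IsEulerSol lam A q₀ μ u u₁) {x : ℝ}
    (hx : x ∈ Set.Ioo 0 A) :
    HasDerivAt (waveComponent μ u u₁) (μ * waveComponent μ u u₁ x +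
      ((-(lam : ℂ) ^ 2 - 1/4) / (x : ℂ) ^ 2 + q₀ x) * u x) x := by
  obtain ⟨h1, h2⟩ := h x hx
  refine (h2.add (h1.const_mul μ)).congr_deriv ?_
  rw [waveComponent]
  ring

lemma hasDerivAt_potentialPrimitive (hΓ : IsWeightPrimitive A q₀ Γ) (ρ K : ℝ) {x : ℝ}
    (hx : x ∈ Set.Ioo 0 A) :
    HasDerivAt (potentialPrimitive lam Γ ρ K)
      ((lam ^ 2 + 1/4) / ρ / x ^ 2 + x * ‖q₀ x‖ / K) x := by
  refine (((hasDerivAt_inv hx.1.ne').const_mul _).add ((hΓ.1 x hx).div_const K)).congr_deriv ?_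
  ring

lemma norm_potential_le {ρ K x : ℝ} (hρ : 0 < ρ) (hK : 0 < K) (hx : K ≤ ρ * x)
    (hx0 : 0 < x) :
    ‖(-(lam : ℂ) ^ 2 - 1/4) / (x : ℂ) ^ 2 + q₀ x‖ ≤
      ρ * ((lam ^ 2 + 1/4) / ρ / x ^ 2 + x * ‖q₀ x‖ / K) := by
  have h1 : ‖(-(lam : ℂ) ^ 2 - 1/4) / (x : ℂ) ^ 2‖ = (lam ^ 2 + 1/4) / x ^ 2 := by
    have : (-(lam : ℂ) ^ 2 - 1/4) / (x : ℂ) ^ 2 = ((-((lam ^ 2 + 1/4) / x ^ 2) : ℝ) : ℂ) := by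
      push_cast; ring
    rw [this, Complex.norm_real, norm_neg, Real.norm_of_nonneg (by positivity)]
  refine (norm_add_le _ _).trans ?_
  rw [h1, mul_add]
  gcongr
  · apply le_of_eq; field_simp
  · rw [← mul_div_assoc, le_div_iff₀ hK]
    nlinarith [norm_nonneg (q₀ x)]

lemma potentialPrimitive_sub_le (hΓ : IsWeightPrimitive A q₀ Γ) {ρ K y x : ℝ} (hρ : 0 < ρ)
    (hK : 0 < K) (hy : K ≤ ρ * y) (hyx : y ≤ x) (hxA : x < A) :
    potentialPrimitive lam Γ ρ K x - potentialPrimitive lam Γ ρ K y ≤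
      (lam ^ 2 + 1/4 + Γ x) / K := by
  have hy0 : 0 < y := by
    by_contra! h
    nlinarith
  have hx0 : 0 < x := hy0.trans_le hyx
  have h1 : 0 ≤ Γ y := hΓ.nonneg ⟨hy0, hyx.trans_lt hxA⟩
  have h2 : (lam ^ 2 + 1/4) / ρ * y⁻¹ ≤ (lam ^ 2 + 1/4) / K := by
    rw [← div_eq_mul_inv, div_div]
    gcongr
  have h3 : 0 ≤ (lam ^ 2 + 1/4) / ρ * x⁻¹ := by positivity
  have h4 : 0 ≤ Γ y / K := by positivity
  rw [potentialPrimitive, potentialPrimitive, add_div _ (Γ x)]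
  linarith

lemma norm_le_waveComponent (x : ℝ) :
    2 * ‖μ‖ * ‖u x‖ ≤ ‖waveComponent μ u u₁ x‖ + ‖waveComponent (-μ) u u₁ x‖ := by
  have h : waveComponent μ u u₁ x - waveComponent (-μ) u u₁ x = 2 * μ * u x := by
    rw [waveComponent, waveComponent]; ring
  have h2 : 2 * ‖μ‖ * ‖u x‖ = ‖2 * μ * u x‖ := by simp
  rw [h2, ← h]
  exact norm_sub_le _ _

lemma IsEulerSol.waveEnergy_le (hΓ : IsWeightPrimitive A q₀ Γ)
    (h : IsEulerSol lam A q₀ μ u u₁) {K y x : ℝ} (hμ : μ ≠ 0) (hK : 0 < K)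
    (hy : K ≤ ‖μ‖ * y) (hyx : y ≤ x) (hxA : x < A) :
    waveEnergy μ u u₁ x ≤ waveEnergy μ u u₁ y *
      Real.exp (2 * |μ.re| * (x - y) + 2 * ((lam ^ 2 + 1/4 + Γ x) / K)) := by
  have hρ : 0 < ‖μ‖ := norm_pos_iff.2 hμ
  have hy0 : 0 < y := by
    by_contra! h
    nlinarith
  have hsub : ∀ t ∈ Set.Icc y x, t ∈ Set.Ioo 0 A := fun t ht =>
    ⟨hy0.trans_le ht.1, ht.2.trans_lt hxA⟩
  have hE : ∀ t ∈ Set.Icc y x, HasDerivAt (waveEnergy μ u u₁) _ t := fun t ht =>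
    (h.hasDerivAt_waveComponent (hsub t ht)).norm_sq.add
      (h.neg_param.hasDerivAt_waveComponent (hsub t ht)).norm_sq
  refine (le_mul_exp_of_deriv_le
    (g := fun t => 2 * |μ.re| * t + 2 * potentialPrimitive lam Γ ‖μ‖ K t) hyx hE
    (fun t ht => ((hasDerivAt_id t).const_mul (2 * |μ.re|)).add
      ((hasDerivAt_potentialPrimitive hΓ _ _ (hsub t ht)).const_mul 2)) ?_).trans ?_
  · intro t ht
    have ht0 := (hsub t ht).1
    have hq := norm_potential_le (lam := lam) (q₀ := q₀) (x := t) hρ hK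
      (hy.trans (by gcongr; exact ht.1)) ht0
    have hu := norm_le_waveComponent (μ := μ) (u := u) (u₁ := u₁) t
    rw [waveEnergy]
    set Q := (-(lam : ℂ) ^ 2 - 1/4) / (t : ℂ) ^ 2 + q₀ t
    set g := (lam ^ 2 + 1/4) / ‖μ‖ / t ^ 2 + t * ‖q₀ t‖ / K
    set p := waveComponent μ u u₁ t
    set m := waveComponent (-μ) u u₁ t
    have hin : ∀ ν z : ℂ, inner ℝ z (ν * z + Q * u t) ≤
        ν.re * ‖z‖ ^ 2 + ‖z‖ * (‖Q‖ * ‖u t‖) := fun ν z => by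
      rw [inner_add_right]
      refine add_le_add (le_of_eq ?_) ((real_inner_le_norm _ _).trans (by rw [norm_mul]))
      rw [Complex.sq_norm, Complex.normSq_apply, Complex.inner]
      simp
      ring
    have h1 := hin μ p
    have h2 := hin (-μ) m
    rw [Complex.neg_re] at h2
    have h3 : ‖Q‖ * ‖u t‖ * (‖p‖ + ‖m‖) ≤ g * (‖p‖ ^ 2 + ‖m‖ ^ 2) := by
      have hg : 0 ≤ g := by positivity
      calc ‖Q‖ * ‖u t‖ * (‖p‖ + ‖m‖) ≤ ‖μ‖ * g * ‖u t‖ * (‖p‖ + ‖m‖) := by gcongr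
        _ = g / 2 * (2 * ‖μ‖ * ‖u t‖) * (‖p‖ + ‖m‖) := by ring
        _ ≤ g / 2 * (‖p‖ + ‖m‖) * (‖p‖ + ‖m‖) := by gcongr
        _ = g / 2 * (‖p‖ + ‖m‖) ^ 2 := by ring
        _ ≤ g / 2 * (2 * (‖p‖ ^ 2 + ‖m‖ ^ 2)) := by
            gcongr; nlinarith [sq_nonneg (‖p‖ - ‖m‖)]
        _ = _ := by ring
    have h4 := mul_le_mul_of_nonneg_right (le_abs_self μ.re) (sq_nonneg ‖p‖)
    have h5 := mul_le_mul_of_nonneg_right (neg_le_abs μ.re) (sq_nonneg ‖m‖)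
    nlinarith
  · have h0 : 0 ≤ waveEnergy μ u u₁ y := by rw [waveEnergy]; positivity
    have := potentialPrimitive_sub_le (lam := lam) hΓ hρ hK hy hyx hxA
    gcongr
    linarith

lemma waveEnergy_le_eulerEnergy (hlam : lam ≠ 0) {x : ℝ} (hx0 : 0 < x) (hx : ‖μ‖ * x = 1) :
    waveEnergy μ u u₁ x ≤
      ‖μ‖ * ((1 / lam ^ 2 + 4 + 2 * (lam ^ 2 + 1/4) / lam ^ 2) * eulerEnergy lam u u₁ x) := by
  have hu := norm_sq_le_eulerEnergy (lam := lam) hx0 u u₁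
  have hu₁ : ‖(x : ℂ) * u₁ x‖ ^ 2 ≤
      2 * (x * eulerEnergy lam u u₁ x) + 2 * ((lam ^ 2 + 1/4) * ‖u x‖ ^ 2) := by
    have h1 : (x : ℂ) * u₁ x = eulerSol lam x * eulerCoeff lam u u₁ x +
        ((1/2 : ℂ) - Complex.I * lam) * u x := by
      rw [eulerCoeff, mul_div_cancel₀ _ (eulerSol_ne_zero hx0)]
      ring
    have h2 : ‖(1/2 : ℂ) - Complex.I * lam‖ ^ 2 = lam ^ 2 + 1/4 := by
      rw [Complex.sq_norm, Complex.normSq_apply]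
      simp
      ring
    have h3 : ‖eulerSol lam x * eulerCoeff lam u u₁ x‖ ^ 2 ≤ x * eulerEnergy lam u u₁ x := by
      rw [norm_mul, mul_pow, norm_eulerSol_sq hx0, eulerEnergy]
      gcongr
      linarith [sq_nonneg ‖eulerCoeff (-lam) u u₁ x‖]
    have h4 : ‖((1/2 : ℂ) - Complex.I * lam) * u x‖ ^ 2 = (lam ^ 2 + 1/4) * ‖u x‖ ^ 2 := by
      rw [norm_mul, mul_pow, h2]
    rw [← h4, h1]
    have h5 := norm_add_le (eulerSol lam x * eulerCoeff lam u u₁ x)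
      (((1/2 : ℂ) - Complex.I * lam) * u x)
    have h6 := pow_le_pow_left₀ (norm_nonneg _) h5 2
    have h7 := add_sq_le (a := ‖eulerSol lam x * eulerCoeff lam u u₁ x‖)
      (b := ‖((1/2 : ℂ) - Complex.I * lam) * u x‖)
    linarith
  have hl : 0 < lam ^ 2 := by positivity
  have hρ : ‖μ‖ = 1 / x := by rw [eq_div_iff hx0.ne', hx]
  rw [norm_mul, mul_pow, Complex.norm_real, Real.norm_of_nonneg hx0.le] at hu₁
  rw [waveEnergy_eq, hρ]
  set e := eulerEnergy lam u u₁ x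
  have hu' : ‖u x‖ ^ 2 ≤ x * e / (2 * lam ^ 2) := by
    rw [le_div_iff₀ (by positivity)]; linarith
  have hu₁' : ‖u₁ x‖ ^ 2 ≤ (2 * (x * e) + 2 * ((lam ^ 2 + 1/4) * (x * e / (2 * lam ^ 2)))) /
      x ^ 2 := by
    rw [le_div_iff₀ (by positivity)]
    have : (lam ^ 2 + 1/4) * ‖u x‖ ^ 2 ≤ (lam ^ 2 + 1/4) * (x * e / (2 * lam ^ 2)) := by gcongr
    linarith
  calc 2 * (‖u₁ x‖ ^ 2 + (1 / x) ^ 2 * ‖u x‖ ^ 2)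
      ≤ 2 * ((2 * (x * e) + 2 * ((lam ^ 2 + 1/4) * (x * e / (2 * lam ^ 2)))) / x ^ 2 +
        (1 / x) ^ 2 * (x * e / (2 * lam ^ 2))) := by gcongr
    _ = _ := by field_simp; ring

/-- Sharp exponential bound for normalized solutions, uniform in the spectral parameter. -/
lemma exists_waveEnergy_le (hlam : lam ≠ 0) (hΓ : IsWeightPrimitive A q₀ Γ) (D : ℝ) :
    ∃ C > 0, ∀ (μ : ℂ) (u u₁ : ℝ → ℂ), IsEulerSol lam A q₀ μ u u₁ →
      IsNormalizedAtZero lam u → ∀ x ∈ Set.Ioo 0 A, Γ x ≤ D → 1 ≤ ‖μ‖ * x →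
        waveEnergy μ u u₁ x ≤ C * ‖μ‖ * Real.exp (2 * |μ.re| * x) := by
  refine ⟨(1 / lam ^ 2 + 4 + 2 * (lam ^ 2 + 1/4) / lam ^ 2) *
    (4 * lam ^ 2 * Real.exp (2 / |lam| * (D + 1 / 2))) *
    Real.exp (2 * (lam ^ 2 + 1/4 + D)), by positivity, ?_⟩
  intro μ u u₁ h hn x hx hD hμx
  have hμ : μ ≠ 0 := by
    rintro rfl
    norm_num at hμx
  have hρ : 0 < ‖μ‖ := norm_pos_iff.2 hμ
  have hy0 : 0 < 1 / ‖μ‖ := by positivity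
  have hy1 : ‖μ‖ * (1 / ‖μ‖) = 1 := by field_simp
  have hyx : 1 / ‖μ‖ ≤ x := by rw [div_le_iff₀ hρ]; linarith
  have hyA : 1 / ‖μ‖ ∈ Set.Ioo 0 A := ⟨hy0, hyx.trans_lt hx.2⟩
  have hDy : Γ (1 / ‖μ‖) ≤ D := (hΓ.mono hy0 hyx hx.2).trans hD
  have h1 := h.waveEnergy_le hΓ hμ one_pos hy1.ge hyx hx.2
  have h2 := waveEnergy_le_eulerEnergy (u := u) (u₁ := u₁) hlam hy0 hy1
  have h3 := h.eulerEnergy_le hlam hΓ hn hyA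
  have h4 : ‖μ‖ ^ 2 * (1 / ‖μ‖) ^ 2 / 2 = 1 / 2 := by field_simp
  rw [h4] at h3
  have h5 : eulerEnergy lam u u₁ (1 / ‖μ‖) ≤
      4 * lam ^ 2 * Real.exp (2 / |lam| * (D + 1 / 2)) := h3.trans (by gcongr)
  have h6 : Real.exp (2 * |μ.re| * (x - 1 / ‖μ‖) + 2 * ((lam ^ 2 + 1/4 + Γ x) / 1)) ≤
      Real.exp (2 * |μ.re| * x) * Real.exp (2 * (lam ^ 2 + 1/4 + D)) := by
    rw [← Real.exp_add, div_one]
    gcongr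
    linarith
  calc _ ≤ _ := h1
    _ ≤ ‖μ‖ * ((1 / lam ^ 2 + 4 + 2 * (lam ^ 2 + 1/4) / lam ^ 2) *
          (4 * lam ^ 2 * Real.exp (2 / |lam| * (D + 1 / 2)))) *
        (Real.exp (2 * |μ.re| * x) * Real.exp (2 * (lam ^ 2 + 1/4 + D))) := by
          gcongr
          exact h2.trans (by gcongr)
    _ = _ := by ring

end FarZone

section RealSpectralParameter

open scoped ComplexConjugate

variable {lam A : ℝ} {q₀ : ℝ → ℂ} {Γ : ℝ → ℝ} {r : ℝ} {u u₁ : ℝ → ℂ}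

lemma eulerCoeff_sq_sub_sq {x : ℝ} (hx : 0 < x) :
    ‖eulerCoeff lam u u₁ x‖ ^ 2 - ‖eulerCoeff (-lam) u u₁ x‖ ^ 2 =
      4 * lam * (u₁ x * conj (u x)).im := by
  rw [eulerCoeff, eulerCoeff, norm_div, norm_div, div_pow, div_pow, norm_eulerSol_sq hx,
    norm_eulerSol_sq hx, ← sub_div, div_eq_iff hx.ne', Complex.sq_norm, Complex.sq_norm,
    Complex.normSq_apply, Complex.normSq_apply]
  simp
  ring

lemma IsEulerSol.hasDerivAt_flux (h : IsEulerSol lam A q₀ r u u₁) {x : ℝ}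
    (hx : x ∈ Set.Ioo 0 A) :
    HasDerivAt (fun t => (u₁ t * conj (u t)).im) ((q₀ x).im * ‖u x‖ ^ 2) x := by
  obtain ⟨h1, h2⟩ := h x hx
  have h3 : HasDerivAt (fun t => conj (u t)) (conj (u₁ x)) x :=
    Complex.conjCLE.toContinuousLinearMap.hasFDerivAt.comp_hasDerivAt x h1
  have h4 := Complex.imCLM.hasFDerivAt.comp_hasDerivAt x (h2.mul h3)
  refine h4.congr_deriv ?_
  have h5 : (-(lam : ℂ) ^ 2 - 1/4) / (x : ℂ) ^ 2 + q₀ x + (r : ℂ) ^ 2 =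
      (((-lam ^ 2 - 1/4) / x ^ 2 + r ^ 2 : ℝ) : ℂ) + q₀ x := by push_cast; ring
  rw [h5, Complex.sq_norm, Complex.normSq_apply]
  simp only [Complex.imCLM_apply, Complex.add_im, Complex.mul_im, Complex.mul_re, Complex.conj_re,
    Complex.conj_im, Complex.add_re, Complex.ofReal_re, Complex.ofReal_im]
  ring

lemma IsEulerSol.tendsto_flux (hlam : lam ≠ 0) (hA : 0 < A)
    (hΓ : IsWeightPrimitive A q₀ Γ) (h : IsEulerSol lam A q₀ r u u₁)
    (hn : IsNormalizedAtZero lam u) :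
    Tendsto (fun t => (u₁ t * conj (u t)).im) (𝓝[>] 0) (𝓝 (-lam)) := by
  obtain ⟨ha, hb⟩ := h.tendsto_eulerCoeff hlam hA hΓ hn
  have h1 := ((ha.norm.pow 2).sub (hb.norm.pow 2)).div_const (4 * lam)
  have h2 : (‖(0 : ℂ)‖ ^ 2 - ‖-(2 * Complex.I * (lam : ℂ))‖ ^ 2) / (4 * lam) = -lam := by
    simp [mul_pow]
    field_simp
    norm_num
  rw [h2] at h1
  refine h1.congr' ?_
  filter_upwards [self_mem_nhdsWithin] with x hx
  rw [eulerCoeff_sq_sub_sq hx]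
  field_simp

lemma IsEulerSol.abs_flux_add_le (hlam : lam ≠ 0)
    (hΓ : IsWeightPrimitive A q₀ Γ) (h : IsEulerSol lam A q₀ r u u₁)
    (hn : IsNormalizedAtZero lam u) {M x : ℝ} (hx : x ∈ Set.Ioo 0 A)
    (hM : ∀ t ∈ Set.Ioc 0 x, eulerEnergy lam u u₁ t ≤ M) :
    |(u₁ x * conj (u x)).im + lam| ≤ M / (2 * lam ^ 2) * Γ x := by
  have hl : 0 < 2 * lam ^ 2 := by positivity
  have h1 : Tendsto (fun y => ‖(u₁ x * conj (u x)).im - (u₁ y * conj (u y)).im‖) (𝓝[>] 0)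
      (𝓝 ‖(u₁ x * conj (u x)).im - -lam‖) :=
    ((h.tendsto_flux hlam (hx.1.trans hx.2) hΓ hn).const_sub _).norm
  have h2 : Tendsto (fun y => M / (2 * lam ^ 2) * Γ x - M / (2 * lam ^ 2) * Γ y) (𝓝[>] 0)
      (𝓝 (M / (2 * lam ^ 2) * Γ x - M / (2 * lam ^ 2) * 0)) := (hΓ.2.const_mul _).const_sub _
  rw [sub_neg_eq_add, Real.norm_eq_abs] at h1
  rw [mul_zero, sub_zero] at h2
  refine le_of_tendsto_of_tendsto h1 h2 ?_
  filter_upwards [Ioo_mem_nhdsGT hx.1] with y hy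
  have hsub : ∀ t ∈ Set.Icc y x, t ∈ Set.Ioo 0 A := fun t ht =>
    ⟨hy.1.trans_le ht.1, ht.2.trans_lt hx.2⟩
  refine norm_sub_le_of_norm_deriv_le (g := fun t => M / (2 * lam ^ 2) * Γ t) hy.2.le
    (fun t ht => h.hasDerivAt_flux (hsub t ht))
    (fun t ht => (hΓ.1 t (hsub t ht)).const_mul _) fun t ht => ?_
  have ht0 := (hsub t ht).1
  have h3 := norm_sq_le_eulerEnergy (lam := lam) ht0 u u₁
  have h4 := hM t ⟨ht0, ht.2⟩
  have h5 : ‖u t‖ ^ 2 ≤ t * M / (2 * lam ^ 2) := by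
    rw [le_div_iff₀ hl]
    nlinarith
  rw [norm_mul, Real.norm_eq_abs, norm_pow, norm_norm]
  calc |(q₀ t).im| * ‖u t‖ ^ 2 ≤ ‖q₀ t‖ * (t * M / (2 * lam ^ 2)) := by
        gcongr; exact Complex.abs_im_le_norm _
    _ = _ := by ring

lemma abs_flux_le (x : ℝ) (hr : 0 < r) :
    2 * r * |(u₁ x * conj (u x)).im| ≤
      ‖waveComponent r u u₁ x‖ * ‖waveComponent (-r) u u₁ x‖ := by
  have h1 : (waveComponent (-r) u u₁ x * conj (waveComponent r u u₁ x)).im =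
      -(2 * r * (u₁ x * conj (u x)).im) + 2 * (2 * r * (u₁ x * conj (u x)).im) := by
    simp [waveComponent]
    ring
  have h2 := Complex.abs_im_le_norm (waveComponent (-r) u u₁ x * conj (waveComponent r u u₁ x))
  rw [h1, norm_mul, RCLike.norm_conj, mul_comm ‖_‖] at h2
  refine le_trans (le_of_eq ?_) h2
  rw [show -(2 * r * (u₁ x * conj (u x)).im) + 2 * (2 * r * (u₁ x * conj (u x)).im) =
    2 * r * (u₁ x * conj (u x)).im by ring, abs_mul, abs_of_pos (by positivity : 0 < 2 * r)]

/-- For large real `r`, the flux keeps both wave components away from zero near the origin. -/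
lemma exists_le_waveComponent_mul (hlam : lam ≠ 0) (hA : 0 < A)
    (hΓ : IsWeightPrimitive A q₀ Γ) {D K : ℝ} (hD : 0 < D) (hK : 0 < K) :
    ∃ R > (0 : ℝ), ∀ r : ℝ, r ≥ R → ∀ u u₁ : ℝ → ℂ, IsEulerSol lam A q₀ r u u₁ → IsNormalizedAtZero lam u →
      ∀ x : ℝ, 0 < x → r * x ≤ K → x ∈ Set.Ioo 0 A ∧ Γ x ≤ D ∧
        |lam| * r ≤ ‖waveComponent r u u₁ x‖ * ‖waveComponent (-r) u u₁ x‖ := by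
  have hl : 0 < |lam| := abs_pos.2 hlam
  have hl2 : 0 < 2 * lam ^ 2 := by positivity
  set M := 4 * lam ^ 2 * Real.exp (2 / |lam| * (D + K ^ 2 / 2)) with hM
  have hM0 : 0 < M := by positivity
  have hev : ∀ᶠ x in 𝓝[>] (0 : ℝ), Γ x < min D (|lam| / 2 / (M / (2 * lam ^ 2))) :=
    hΓ.2.eventually_lt_const (by positivity)
  obtain ⟨η, hη, hηA⟩ := (hev.and (Ioo_mem_nhdsGT hA)).exists
  refine ⟨K / η, div_pos hK hηA.1, fun r hr u u₁ h hn x hx0 hx => ?_⟩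
  have hr0 : 0 < r := (div_pos hK hηA.1).trans_le hr
  have hxη : x ≤ η := by
    have h1 : K ≤ r * η := (div_le_iff₀ hηA.1).1 hr
    exact le_of_mul_le_mul_left (hx.trans h1) hr0
  have hxA : x ∈ Set.Ioo 0 A := ⟨hx0, hxη.trans_lt hηA.2⟩
  have hΓx : Γ x < min D (|lam| / 2 / (M / (2 * lam ^ 2))) :=
    (hΓ.mono hx0 hxη hηA.2).trans_lt hη
  have hΓD : Γ x ≤ D := (hΓx.trans_le (min_le_left _ _)).le
  refine ⟨hxA, hΓD, ?_⟩
  have hE : ∀ t ∈ Set.Ioc 0 x, eulerEnergy lam u u₁ t ≤ M := fun t ht => by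
    refine (h.eulerEnergy_le hlam hΓ hn ⟨ht.1, ht.2.trans_lt hxA.2⟩).trans ?_
    have h1 : Γ t ≤ D := (hΓ.mono ht.1 ht.2 hxA.2).trans hΓD
    have h2 : ‖(r : ℂ)‖ ^ 2 * t ^ 2 ≤ K ^ 2 := by
      rw [Complex.norm_real, Real.norm_of_nonneg hr0.le, ← mul_pow]
      have h3 : r * t ≤ K := le_trans (by gcongr; exact ht.2) hx
      have h4 := ht.1
      gcongr
    rw [hM]
    gcongr
  have h1 := h.abs_flux_add_le hlam hΓ hn hxA hE
  have h2 : M / (2 * lam ^ 2) * Γ x ≤ |lam| / 2 := by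
    have := (hΓx.trans_le (min_le_right _ _)).le
    rw [le_div_iff₀ (by positivity)] at this
    linarith
  have h3 := abs_flux_le (u := u) (u₁ := u₁) x hr0
  have h4 : |lam| ≤ |(u₁ x * conj (u x)).im + lam| + |(u₁ x * conj (u x)).im| := by
    have := abs_sub ((u₁ x * conj (u x)).im + lam) (u₁ x * conj (u x)).im
    rwa [add_sub_cancel_left] at this
  nlinarith

lemma IsEulerSol.hasDerivAt_exp_smul (h : IsEulerSol lam A q₀ r u u₁) {x : ℝ}
    (hx : x ∈ Set.Ioo 0 A) :
    HasDerivAt (fun t => Real.exp (-r * t) • waveComponent r u u₁ t)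
      (Real.exp (-r * x) • (((-(lam : ℂ) ^ 2 - 1/4) / (x : ℂ) ^ 2 + q₀ x) * u x)) x := by
  have h1 := (((hasDerivAt_id x).const_mul (-r)).exp).smul (h.hasDerivAt_waveComponent hx)
  refine h1.congr_deriv ?_
  simp only [Complex.real_smul, id_eq]
  push_cast
  ring

lemma IsEulerSol.neg_real (h : IsEulerSol lam A q₀ r u u₁) :
    IsEulerSol lam A q₀ ((-r : ℝ) : ℂ) u u₁ := by
  simpa [IsEulerSol] using h

/-- Once the growing component dominates, it keeps growing at the exponential rate `r`. -/
lemma IsEulerSol.wave_persistence (hΓ : IsWeightPrimitive A q₀ Γ)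
    (h : IsEulerSol lam A q₀ r u u₁) {K y x : ℝ} (hr : 0 < r) (hK : 0 < K)
    (hy : K ≤ r * y) (hyx : y ≤ x) (hxA : x < A) (hKx : (lam ^ 2 + 1/4 + Γ x) / K ≤ 1 / 100)
    (hdom : ‖waveComponent (-r) u u₁ y‖ ≤ ‖waveComponent r u u₁ y‖) :
    98 / 100 * (‖waveComponent r u u₁ y‖ * Real.exp (r * (x - y))) ≤ ‖waveComponent r u u₁ x‖ ∧
    ‖waveComponent (-r) u u₁ x‖ ≤ ‖waveComponent r u u₁ y‖ * Real.exp (-(r * (x - y))) +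
      2 / 100 * (‖waveComponent r u u₁ y‖ * Real.exp (r * (x - y))) := by
  have hnr : ‖(r : ℂ)‖ = r := by rw [Complex.norm_real, Real.norm_of_nonneg hr.le]
  have hy0 : 0 < y := by
    by_contra! h
    nlinarith
  have hsub : ∀ t ∈ Set.Icc y x, t ∈ Set.Ioo 0 A := fun t ht =>
    ⟨hy0.trans_le ht.1, ht.2.trans_lt hxA⟩
  set P := ‖waveComponent r u u₁ y‖ with hP
  have hG := fun t ht => hasDerivAt_potentialPrimitive (lam := lam) hΓ r K (hsub t ht)
  have hGd := potentialPrimitive_sub_le (lam := lam) hΓ hr hK hy hyx hxA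
  set G := potentialPrimitive lam Γ r K
  have hQu : ∀ t ∈ Set.Icc y x, ‖((-(lam : ℂ) ^ 2 - 1/4) / (t : ℂ) ^ 2 + q₀ t) * u t‖ ≤
      2 * P * Real.exp (r * (t - y)) * ((lam ^ 2 + 1/4) / r / t ^ 2 + t * ‖q₀ t‖ / K) := by
    intro t ht
    have ht0 := (hsub t ht).1
    have hq := norm_potential_le (lam := lam) (q₀ := q₀) (x := t) hr hK
      (hy.trans (by gcongr; exact ht.1)) ht0
    have hu := norm_le_waveComponent (μ := r) (u := u) (u₁ := u₁) t
    have hE := h.waveEnergy_le (K := K) (y := y) (x := t) hΓ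
      (by exact_mod_cast hr.ne') hK (by rwa [hnr]) ht.1 (hsub t ht).2
    rw [hnr] at hu
    rw [Complex.ofReal_re, abs_of_pos hr] at hE
    have hΓt := hΓ.mono ht0 ht.2 hxA
    have hexp : Real.exp (2 * r * (t - y) + 2 * ((lam ^ 2 + 1/4 + Γ t) / K)) ≤
        Real.exp (r * (t - y)) ^ 2 * 3 := by
      rw [Real.exp_add, ← Real.exp_nat_mul]
      have h1 : 2 * ((lam ^ 2 + 1/4 + Γ t) / K) ≤ 1 := by
        have : (lam ^ 2 + 1/4 + Γ t) / K ≤ (lam ^ 2 + 1/4 + Γ x) / K := by gcongr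
        linarith
      have h2 : Real.exp (2 * ((lam ^ 2 + 1/4 + Γ t) / K)) ≤ 3 :=
        (Real.exp_le_exp.2 h1).trans Real.exp_one_lt_three.le
      push_cast
      rw [mul_assoc]
      gcongr
    have hEy : waveEnergy r u u₁ y ≤ 2 * P ^ 2 := by
      rw [waveEnergy, ← hP]
      nlinarith [norm_nonneg (waveComponent (-r) u u₁ y)]
    have hru : r * ‖u t‖ ≤ 2 * P * Real.exp (r * (t - y)) := by
      refine le_of_sq_le_sq ?_ (by positivity)
      have h1 : (2 * r * ‖u t‖) ^ 2 ≤ 2 * waveEnergy r u u₁ t := by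
        refine (pow_le_pow_left₀ (by positivity) hu 2).trans ?_
        rw [waveEnergy]
        exact add_sq_le
      have h2 : waveEnergy r u u₁ t ≤ 2 * P ^ 2 * (Real.exp (r * (t - y)) ^ 2 * 3) := by
        refine hE.trans ?_
        gcongr
      nlinarith [sq_nonneg (P * Real.exp (r * (t - y)))]
    set g := (lam ^ 2 + 1/4) / r / t ^ 2 + t * ‖q₀ t‖ / K
    have hg : 0 ≤ g := by positivity
    rw [norm_mul]
    calc _ ≤ r * g * ‖u t‖ := by gcongr
      _ = r * ‖u t‖ * g := by ring
      _ ≤ _ := by gcongr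
  have hexp1 : 0 < Real.exp (r * x) := Real.exp_pos _
  constructor
  · have h1 := norm_sub_le_of_norm_deriv_le (g := fun t => 2 * P * Real.exp (-r * y) * G t) hyx
      (fun t ht => h.hasDerivAt_exp_smul (hsub t ht)) (fun t ht => (hG t ht).const_mul _)
      (fun t ht => by
        rw [norm_smul, Real.norm_of_nonneg (Real.exp_pos _).le]
        calc _ ≤ Real.exp (-r * t) * (2 * P * Real.exp (r * (t - y)) *
              ((lam ^ 2 + 1/4) / r / t ^ 2 + t * ‖q₀ t‖ / K)) := by gcongr; exact hQu t ht
          _ = 2 * P * (Real.exp (-r * t) * Real.exp (r * (t - y))) *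
              ((lam ^ 2 + 1/4) / r / t ^ 2 + t * ‖q₀ t‖ / K) := by ring
          _ = _ := by rw [← Real.exp_add]; ring_nf)
    have h2 : 2 * P * Real.exp (-r * y) * G x - 2 * P * Real.exp (-r * y) * G y ≤
        2 * P * Real.exp (-r * y) * (1 / 100) := by
      rw [← mul_sub]
      gcongr
      exact hGd.trans hKx
    have h3 := (norm_sub_norm_le _ _).trans ((norm_sub_rev _ _).le.trans (h1.trans h2))
    rw [norm_smul, norm_smul, Real.norm_of_nonneg (Real.exp_pos _).le,
      Real.norm_of_nonneg (Real.exp_pos _).le, ← hP] at h3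
    have h4 : 98 / 100 * P * Real.exp (-r * y) ≤
        Real.exp (-r * x) * ‖waveComponent r u u₁ x‖ := by linarith
    have h5 := mul_le_mul_of_nonneg_left h4 hexp1.le
    have h6 : Real.exp (r * x) * Real.exp (-r * x) = 1 := by
      rw [← Real.exp_add]; simp
    rw [← mul_assoc (Real.exp (r * x)) (Real.exp (-r * x)), h6, one_mul] at h5
    refine le_trans (le_of_eq ?_) h5
    rw [show r * (x - y) = r * x + -r * y by ring, Real.exp_add]
    ring
  · have h1 := norm_sub_le_of_norm_deriv_le
      (g := fun t => 2 * P * Real.exp (r * (2 * x - y)) * G t) hyx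
      (fun t ht => h.neg_real.hasDerivAt_exp_smul (hsub t ht)) (fun t ht => (hG t ht).const_mul _)
      (fun t ht => by
        rw [norm_smul, Real.norm_of_nonneg (Real.exp_pos _).le]
        have hg : 0 ≤ (lam ^ 2 + 1/4) / r / t ^ 2 + t * ‖q₀ t‖ / K := by
          have := (hsub t ht).1
          positivity
        calc _ ≤ Real.exp (- -r * t) * (2 * P * Real.exp (r * (t - y)) *
              ((lam ^ 2 + 1/4) / r / t ^ 2 + t * ‖q₀ t‖ / K)) := by gcongr; exact hQu t ht
          _ = 2 * P * (Real.exp (- -r * t) * Real.exp (r * (t - y))) *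
              ((lam ^ 2 + 1/4) / r / t ^ 2 + t * ‖q₀ t‖ / K) := by ring
          _ ≤ _ := by
            rw [← Real.exp_add]
            gcongr
            nlinarith [ht.2])
    have h2 : 2 * P * Real.exp (r * (2 * x - y)) * G x - 2 * P * Real.exp (r * (2 * x - y)) * G y ≤
        2 * P * Real.exp (r * (2 * x - y)) * (1 / 100) := by
      rw [← mul_sub]
      gcongr
      exact hGd.trans hKx
    have h3 := (norm_sub_norm_le _ _).trans (h1.trans h2)
    rw [norm_smul, norm_smul, Real.norm_of_nonneg (Real.exp_pos _).le,
      Real.norm_of_nonneg (Real.exp_pos _).le, Complex.ofReal_neg, neg_neg] at h3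
    have h4 : Real.exp (r * x) * ‖waveComponent (-r) u u₁ x‖ ≤
        P * Real.exp (r * y) + 2 / 100 * P * Real.exp (r * (2 * x - y)) := by
      have := mul_le_mul_of_nonneg_left hdom (Real.exp_pos (r * y)).le
      linarith
    refine le_of_mul_le_mul_left (h4.trans (le_of_eq ?_)) hexp1
    rw [show r * (2 * x - y) = r * x + r * (x - y) by ring,
      show r * y = r * x + -(r * (x - y)) by ring, Real.exp_add, Real.exp_add]
    ring

lemma exists_dominant_waveComponent (hlam : lam ≠ 0) (hA : 0 < A)
    (hΓ : IsWeightPrimitive A q₀ Γ) {D K : ℝ} (hD : 0 < D) (hK : 1 ≤ K)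
    (hDK : (lam ^ 2 + 1/4 + D) / K ≤ 1 / 100) :
    ∃ K₂ > (0 : ℝ), ∃ R > (0 : ℝ), ∀ r : ℝ, r ≥ R → ∀ u u₁ : ℝ → ℂ, IsEulerSol lam A q₀ r u u₁ →
      IsNormalizedAtZero lam u → ∃ y : ℝ, K ≤ r * y ∧ r * y ≤ K₂ ∧
        ‖waveComponent (-r) u u₁ y‖ ≤ ‖waveComponent r u u₁ y‖ ∧
        |lam| * r ≤ ‖waveComponent r u u₁ y‖ ^ 2 := by
  have hl : 0 < |lam| := abs_pos.2 hlam
  have hK0 : 0 < K := by linarith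
  obtain ⟨C, hC, hCb⟩ := exists_waveEnergy_le (A := A) hlam hΓ D
  obtain ⟨L, hL0, hL⟩ : ∃ L > 0, C * Real.exp (2 * K + 1 - 2 * L) < |lam| := by
    have h1 : Tendsto (fun L : ℝ => C * Real.exp (2 * K + 1 - 2 * L)) atTop (𝓝 (C * 0)) := by
      refine (Real.tendsto_exp_atBot.comp ?_).const_mul C
      exact tendsto_atBot_add_const_left _ _
        (tendsto_neg_atTop_atBot.comp (tendsto_id.const_mul_atTop two_pos))
    rw [mul_zero] at h1
    obtain ⟨L, h2, h3⟩ := ((h1.eventually_lt_const hl).and (eventually_gt_atTop 0)).exists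
    exact ⟨L, h3, h2⟩
  obtain ⟨R, hR0, hR⟩ := exists_le_waveComponent_mul (q₀ := q₀) hlam hA hΓ hD
    (show 0 < K + L by linarith)
  refine ⟨K + L, by linarith, R, hR0, fun r hr u u₁ h hn => ?_⟩
  have hr0 : 0 < r := hR0.trans_le hr
  have hnr : ‖(r : ℂ)‖ = r := by rw [Complex.norm_real, Real.norm_of_nonneg hr0.le]
  have hflux := hR r hr u u₁ h hn
  by_contra! hcon
  have hpos : ∀ y, K ≤ r * y → 0 < y := fun y hy => by
    by_contra! h
    nlinarith
  have hlt : ∀ y, K ≤ r * y → r * y ≤ K + L →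
      ‖waveComponent r u u₁ y‖ < ‖waveComponent (-r) u u₁ y‖ := fun y hy hy2 => by
    by_contra! hdom
    have h1 := hcon y hy hy2 hdom
    have h2 := (hflux y (hpos y hy) hy2).2.2
    nlinarith [norm_nonneg (waveComponent r u u₁ y)]
  have hy0 : r * (K / r) = K := by field_simp
  have hy2 : r * ((K + L) / r) = K + L := by field_simp
  have hyy : K / r ≤ (K + L) / r := by gcongr; linarith
  set y₀ := K / r
  set y₂ := (K + L) / r
  obtain ⟨hy2A, hΓ2, hprod⟩ := hflux y₂ (hpos y₂ (by linarith)) hy2.le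
  obtain ⟨hy0A, hΓ0, -⟩ := hflux y₀ (hpos y₀ (by linarith)) (by linarith)
  have hsub : ∀ t ∈ Set.Icc y₀ y₂, t ∈ Set.Ioo 0 A := fun t ht =>
    ⟨hy0A.1.trans_le ht.1, ht.2.trans_lt hy2A.2⟩
  have hgron := le_mul_exp_of_deriv_le
    (g := fun t => -2 * r * t + 2 * potentialPrimitive lam Γ r K t) hyy
    (fun t ht => (h.neg_param.hasDerivAt_waveComponent (hsub t ht)).norm_sq)
    (fun t ht => ((hasDerivAt_id t).const_mul (-2 * r)).add
      ((hasDerivAt_potentialPrimitive hΓ _ _ (hsub t ht)).const_mul 2))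
    (fun t ht => by
      have ht1 : K ≤ r * t := hy0.ge.trans (by gcongr; exact ht.1)
      have ht2 : r * t ≤ K + L := le_trans (by gcongr; exact ht.2) hy2.le
      have hq := norm_potential_le (lam := lam) (q₀ := q₀) (x := t) hr0 hK0 ht1 (hsub t ht).1
      have hu := norm_le_waveComponent (μ := r) (u := u) (u₁ := u₁) t
      have hm := hlt t ht1 ht2
      rw [hnr] at hu
      set Q := (-(lam : ℂ) ^ 2 - 1/4) / (t : ℂ) ^ 2 + q₀ t
      set g := (lam ^ 2 + 1/4) / r / t ^ 2 + t * ‖q₀ t‖ / K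
      set m := waveComponent (-r) u u₁ t
      have hg : 0 ≤ g := by have := (hsub t ht).1; positivity
      have hin : inner ℝ m (-(r : ℂ) * m + Q * u t) ≤ -r * ‖m‖ ^ 2 + ‖m‖ * (‖Q‖ * ‖u t‖) := by
        rw [inner_add_right]
        refine add_le_add (le_of_eq ?_) ((real_inner_le_norm _ _).trans (by rw [norm_mul]))
        rw [Complex.sq_norm, Complex.normSq_apply, Complex.inner]
        simp
        ring
      have h3 : ‖m‖ * (‖Q‖ * ‖u t‖) ≤ g * ‖m‖ ^ 2 := by
        calc ‖m‖ * (‖Q‖ * ‖u t‖) ≤ ‖m‖ * (r * g * ‖u t‖) := by gcongr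
          _ = ‖m‖ * g * (r * ‖u t‖) := by ring
          _ ≤ ‖m‖ * g * ‖m‖ := by gcongr; linarith
          _ = _ := by ring
      nlinarith)
  have hGd := potentialPrimitive_sub_le (lam := lam) hΓ hr0 hK0 hy0.ge hyy hy2A.2
  have hGD : (lam ^ 2 + 1/4 + Γ y₂) / K ≤ (lam ^ 2 + 1/4 + D) / K := by gcongr
  have hE0 := hCb r u u₁ h hn y₀ hy0A hΓ0 (by rw [hnr, hy0]; exact hK)
  rw [hnr, Complex.ofReal_re, abs_of_pos hr0, show 2 * r * y₀ = 2 * K by rw [mul_assoc, hy0]] at hE0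
  have hm0 : ‖waveComponent (-r) u u₁ y₀‖ ^ 2 ≤ C * r * Real.exp (2 * K) := by
    refine le_trans ?_ hE0
    rw [waveEnergy]
    linarith [sq_nonneg ‖waveComponent r u u₁ y₀‖]
  have hm2 : ‖waveComponent (-r) u u₁ y₂‖ ^ 2 ≤
      C * r * Real.exp (2 * K) * Real.exp (1 - 2 * L) := by
    refine hgron.trans (mul_le_mul hm0 (Real.exp_le_exp.2 ?_) (Real.exp_pos _).le (by positivity))
    nlinarith
  have hp2 := hlt y₂ (by linarith) hy2.le
  have h5 : C * r * Real.exp (2 * K) * Real.exp (1 - 2 * L) =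
      r * (C * Real.exp (2 * K + 1 - 2 * L)) := by
    rw [show 2 * K + 1 - 2 * L = 2 * K + (1 - 2 * L) by ring, Real.exp_add]
    ring
  have h6 := mul_lt_mul_of_pos_left hL hr0
  nlinarith [norm_nonneg (waveComponent (-r) u u₁ y₂)]

/-- Normalized solutions grow at the full exponential rate for large real parameter. -/
lemma exists_le_waveComponent (hlam : lam ≠ 0) (hΓ : IsWeightPrimitive A q₀ Γ) {x : ℝ}
    (hx : x ∈ Set.Ioo 0 A) :
    ∃ c > (0 : ℝ), ∃ R > (0 : ℝ), ∀ r : ℝ, r ≥ R → ∀ u u₁ : ℝ → ℂ, IsEulerSol lam A q₀ r u u₁ →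
      IsNormalizedAtZero lam u → c * r * Real.exp (2 * r * x) ≤ ‖waveComponent r u u₁ x‖ ^ 2 ∧
        ‖waveComponent (-r) u u₁ x‖ ≤ ‖waveComponent r u u₁ x‖ / 2 := by
  have hl : 0 < |lam| := abs_pos.2 hlam
  have hΓx := hΓ.nonneg hx
  set D := Γ x + 1 with hD
  set K := 100 * (lam ^ 2 + 1/4 + D) with hK
  have hK1 : 1 ≤ K := by nlinarith [sq_nonneg lam]
  have hDK : (lam ^ 2 + 1/4 + D) / K ≤ 1 / 100 := by
    rw [div_le_iff₀ (by linarith)]; linarith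
  obtain ⟨K₂, hK₂, R, hR, hmain⟩ := exists_dominant_waveComponent (q₀ := q₀) hlam
    (hx.1.trans hx.2) hΓ (D := D) (by linarith) hK1 hDK
  refine ⟨|lam| * Real.exp (-2 * K₂) / 2, by positivity, max R ((K₂ + 1) / x),
    lt_max_of_lt_left hR, fun r hr u u₁ h hn => ?_⟩
  have hr0 : 0 < r := hR.trans_le ((le_max_left _ _).trans hr)
  obtain ⟨y, hy1, hy2, hdom, hlow⟩ := hmain r ((le_max_left _ _).trans hr) u u₁ h hn
  have hrx : K₂ + 1 ≤ r * x := (div_le_iff₀ hx.1).1 ((le_max_right _ _).trans hr)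
  have hyx : y ≤ x := le_of_mul_le_mul_left (by linarith) hr0
  have hKx : (lam ^ 2 + 1/4 + Γ x) / K ≤ 1 / 100 := by
    refine le_trans ?_ hDK
    gcongr
    linarith
  obtain ⟨h1, h2⟩ := h.wave_persistence hΓ hr0 (by linarith) hy1 hyx hx.2 hKx hdom
  set P := ‖waveComponent r u u₁ y‖
  have hP : 0 ≤ P := norm_nonneg _
  have hs : 1 ≤ r * (x - y) := by linarith
  have he : 2 ≤ Real.exp (r * (x - y)) := by linarith [Real.add_one_le_exp (r * (x - y))]
  have he2 : Real.exp (-(r * (x - y))) ≤ 1 / 4 * Real.exp (r * (x - y)) := by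
    rw [Real.exp_neg]
    calc (Real.exp (r * (x - y)))⁻¹ ≤ 2⁻¹ := by gcongr
      _ ≤ _ := by linarith
  have h3 : P * Real.exp (-(r * (x - y))) ≤ 1 / 4 * (P * Real.exp (r * (x - y))) := by
    have := mul_le_mul_of_nonneg_left he2 hP
    linarith
  have hPe : 0 ≤ P * Real.exp (r * (x - y)) := by positivity
  refine ⟨?_, by linarith⟩
  have h4 : 1 / 2 * (P * Real.exp (r * (x - y))) ^ 2 ≤ ‖waveComponent r u u₁ x‖ ^ 2 := by
    nlinarith
  refine le_trans ?_ h4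
  have h5 : Real.exp (-2 * K₂) * Real.exp (2 * r * x) ≤ Real.exp (r * (x - y)) ^ 2 := by
    rw [← Real.exp_add, ← Real.exp_nat_mul]
    gcongr
    push_cast
    linarith
  calc |lam| * Real.exp (-2 * K₂) / 2 * r * Real.exp (2 * r * x)
      = 1 / 2 * ((|lam| * r) * (Real.exp (-2 * K₂) * Real.exp (2 * r * x))) := by ring
    _ ≤ 1 / 2 * (P ^ 2 * Real.exp (r * (x - y)) ^ 2) := by gcongr
    _ = _ := by ring

end RealSpectralParameter

section Conversion

variable {lam A : ℝ} {q q₀ q₁ : ℝ → ℂ} {Γ : ℝ → ℝ} {μ : ℂ} {u v : ℝ → ℂ}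

lemma exists_isWeightPrimitive (hc : ContinuousOn q₀ (Set.Ioo 0 A))
    (hi : IntegrableOn (fun t : ℝ => t * ‖q₀ t‖) (Set.Ioo 0 (A / 2))) :
    ∃ Γ, IsWeightPrimitive A q₀ Γ := by
  rcases le_or_gt A 0 with hA | hA
  · exact ⟨fun _ => 0, fun x hx => absurd (hx.1.trans hx.2) hA.not_gt, tendsto_const_nhds⟩
  have hcont : ContinuousOn (fun t : ℝ => t * ‖q₀ t‖) (Set.Ioo 0 A) :=
    continuousOn_id.mul hc.norm
  have hhalf : IntervalIntegrable (fun t : ℝ => t * ‖q₀ t‖) volume 0 (A / 2) :=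
    (intervalIntegrable_iff_integrableOn_Ioo_of_le (by positivity)).2 hi
  have hint : ∀ x ∈ Set.Ioo 0 A, IntervalIntegrable (fun t : ℝ => t * ‖q₀ t‖) volume 0 x := by
    intro x hx
    refine hhalf.trans (hcont.mono ?_).intervalIntegrable
    exact Set.OrdConnected.uIcc_subset Set.ordConnected_Ioo ⟨by linarith, by linarith⟩ hx
  refine ⟨fun x => ∫ t in (0 : ℝ)..x, t * ‖q₀ t‖, fun x hx => ?_, ?_⟩
  · exact intervalIntegral.integral_hasDerivAt_right (hint x hx)
      (hcont.stronglyMeasurableAtFilter isOpen_Ioo x hx)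
      (hcont.continuousAt (isOpen_Ioo.mem_nhds hx))
  · have h1 := intervalIntegral.continuousOn_primitive_interval
      ((intervalIntegrable_iff' (a := 0) (b := A / 2)).1 hhalf)
    have h2 := h1 0 Set.left_mem_uIcc
    rw [Set.uIcc_of_le (by positivity : 0 ≤ A / 2)] at h2
    have h3 := h2.mono_left (nhdsWithin_mono 0 Set.Ioo_subset_Icc_self)
    simpa [nhdsWithin_Ioo_eq_nhdsGT (by positivity : 0 < A / 2)] using h3

lemma SolvesRadialODE.hasDerivAt_deriv (h : SolvesRadialODE A q μ u) {x : ℝ}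
    (hx : x ∈ Set.Ioo 0 A) : HasDerivAt (deriv u) ((q x + μ ^ 2) * u x) x := by
  obtain ⟨-, h2, -, h4⟩ := h x hx
  refine h2.hasDerivAt.congr_deriv ?_
  linear_combination -h4

lemma SolvesRadialODE.isEulerSol (h : SolvesRadialODE A q μ u)
    (hq : ∀ x ∈ Set.Ioo (0 : ℝ) A, q x = (-(lam : ℂ) ^ 2 - 1/4) / (x : ℂ) ^ 2 + q₀ x) :
    IsEulerSol lam A q₀ μ u (deriv u) := fun x hx => by
  rw [← hq x hx]
  exact ⟨(h x hx).1.hasDerivAt, h.hasDerivAt_deriv hx⟩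

lemma sub_mem_Ioo_zero {x : ℝ} (hx : x ∈ Set.Ioo 0 A) : A - x ∈ Set.Ioo 0 A :=
  ⟨by linarith [hx.2], by linarith [hx.1]⟩

lemma SolvesRadialODE.isEulerSol_reflect (h : SolvesRadialODE A q μ u)
    (hq : ∀ x ∈ Set.Ioo (0 : ℝ) A,
      q x = (-(lam : ℂ) ^ 2 - 1/4) / ((A : ℂ) - (x : ℂ)) ^ 2 + q₁ x) :
    IsEulerSol lam A (fun t => q₁ (A - t)) μ (fun t => u (A - t))
      (fun t => -deriv u (A - t)) := fun x hx => by
  have hx' := sub_mem_Ioo_zero hx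
  have hq' := hq _ hx'
  rw [Complex.ofReal_sub, sub_sub_cancel] at hq'
  rw [← hq']
  have hs : HasDerivAt (fun t : ℝ => A - t) (-1) x := (hasDerivAt_id x).const_sub A
  refine ⟨?_, ?_⟩
  · exact ((h _ hx').1.hasDerivAt.scomp x hs).congr_deriv (by simp)
  · exact ((h.hasDerivAt_deriv hx').scomp x hs).neg.congr_deriv (by simp)

lemma IsAdmissible.exists_left (h : IsAdmissible lam A q) :
    ∃ (q₀ : ℝ → ℂ) (Γ : ℝ → ℝ), (∀ x ∈ Set.Ioo (0 : ℝ) A,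
      q x = (-(lam : ℂ) ^ 2 - 1/4) / (x : ℂ) ^ 2 + q₀ x) ∧ IsWeightPrimitive A q₀ Γ := by
  obtain ⟨hc, ⟨q₀, hq, hi⟩, -⟩ := h
  have hc₀ : ContinuousOn q₀ (Set.Ioo 0 A) := by
    have : ContinuousOn (fun x : ℝ => q x - (-(lam : ℂ) ^ 2 - 1/4) / (x : ℂ) ^ 2)
        (Set.Ioo 0 A) := by
      refine hc.sub (ContinuousOn.div continuousOn_const (by fun_prop) fun x hx => ?_)
      have : (x : ℂ) ≠ 0 := by exact_mod_cast hx.1.ne'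
      positivity
    refine this.congr fun x hx => ?_
    simp only [hq x hx]; ring
  obtain ⟨Γ, hΓ⟩ := exists_isWeightPrimitive hc₀ hi
  exact ⟨q₀, Γ, hq, hΓ⟩

lemma IsAdmissible.exists_right (h : IsAdmissible lam A q) :
    ∃ (q₁ : ℝ → ℂ) (Γ : ℝ → ℝ), (∀ x ∈ Set.Ioo (0 : ℝ) A,
      q x = (-(lam : ℂ) ^ 2 - 1/4) / ((A : ℂ) - (x : ℂ)) ^ 2 + q₁ x) ∧
      IsWeightPrimitive A (fun t => q₁ (A - t)) Γ := by
  obtain ⟨hc, -, ⟨q₁, hq, hi⟩⟩ := h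
  have hc₁ : ContinuousOn q₁ (Set.Ioo 0 A) := by
    have : ContinuousOn (fun x : ℝ => q x - (-(lam : ℂ) ^ 2 - 1/4) / ((A : ℂ) - (x : ℂ)) ^ 2)
        (Set.Ioo 0 A) := by
      refine hc.sub (ContinuousOn.div continuousOn_const (by fun_prop) fun x hx => ?_)
      have : (A : ℂ) - (x : ℂ) ≠ 0 := by
        rw [sub_ne_zero]; exact_mod_cast hx.2.ne'
      positivity
    refine this.congr fun x hx => ?_
    simp only [hq x hx]; ring
  rcases le_or_gt A 0 with hA | hA
  · exact ⟨q₁, fun _ => 0, hq, fun x hx => absurd (hx.1.trans hx.2) hA.not_gt,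
      tendsto_const_nhds⟩
  have hi' : IntegrableOn (fun t : ℝ => t * ‖q₁ (A - t)‖) (Set.Ioo 0 (A / 2)) := by
    have h1 := (intervalIntegrable_iff_integrableOn_Ioo_of_le (by linarith)).2 hi
    rw [← intervalIntegrable_iff_integrableOn_Ioo_of_le (by linarith)]
    simpa [sub_half] using (h1.comp_sub_left (c := A) enorm_ne_top).symm
  obtain ⟨Γ, hΓ⟩ := exists_isWeightPrimitive
    (hc₁.comp (continuousOn_const.sub continuousOn_id) fun x hx => sub_mem_Ioo_zero hx) hi'
  exact ⟨q₁, Γ, hq, hΓ⟩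

lemma inv_eulerSol (x : ℝ) :
    (eulerSol lam x)⁻¹ = (x : ℂ) ^ ((-1/2 : ℂ) - Complex.I * lam) := by
  rw [eulerSol, ← Complex.cpow_neg]
  ring_nf

lemma isNormalizedAtZero_iff :
    IsNormalizedAtZero lam u ↔
      Tendsto (fun x => u x * (x : ℂ) ^ ((-1/2 : ℂ) + Complex.I * lam)) (𝓝[>] 0) (𝓝 1) := by
  simp [IsNormalizedAtZero, div_eq_mul_inv, inv_eulerSol]

lemma isNormalizedAtZero_reflect
    (h : Tendsto (fun x : ℝ => u x * ((A : ℂ) - (x : ℂ)) ^ ((-1/2 : ℂ) + Complex.I * lam))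
      (𝓝[<] A) (𝓝 1)) : IsNormalizedAtZero lam (fun t => u (A - t)) := by
  rw [isNormalizedAtZero_iff]
  have h1 : Tendsto (fun t : ℝ => A - t) (𝓝[>] 0) (𝓝[<] A) := by
    refine tendsto_nhdsWithin_of_tendsto_nhds_of_eventually_within _ ?_ ?_
    · have : Tendsto (fun t : ℝ => A - t) (𝓝 0) (𝓝 (A - 0)) :=
        (continuous_const.sub continuous_id).tendsto 0
      rw [sub_zero] at this
      exact this.mono_left nhdsWithin_le_nhds
    · filter_upwards [self_mem_nhdsWithin] with t ht
      exact sub_lt_self A ht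
  refine (h.comp h1).congr fun t => ?_
  simp

/-- The Wronskian of two solutions is constant. -/
lemma SolvesRadialODE.wronskian_eq (hu : SolvesRadialODE A q μ u) (hv : SolvesRadialODE A q μ v)
    {x y : ℝ} (hx : x ∈ Set.Ioo 0 A) (hy : y ∈ Set.Ioo 0 A) :
    u x * deriv v x - deriv u x * v x = u y * deriv v y - deriv u y * v y := by
  have hd : ∀ t ∈ Set.Ioo 0 A,
      HasDerivAt (fun t => u t * deriv v t - deriv u t * v t) 0 t := fun t ht => by
    have h1 := ((hu t ht).1.hasDerivAt.mul (hv.hasDerivAt_deriv ht)).sub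
      ((hu.hasDerivAt_deriv ht).mul (hv t ht).1.hasDerivAt)
    exact h1.congr_deriv (by ring)
  exact isOpen_Ioo.is_const_of_deriv_eq_zero isPreconnected_Ioo
    (fun t ht => (hd t ht).differentiableAt.differentiableWithinAt)
    (fun t ht => (hd t ht).deriv) hx hy

lemma eulerCoeff_mul_sub (u u₁ v v₁ : ℝ → ℂ) {x : ℝ} (hx : 0 < x) :
    eulerCoeff lam u u₁ x * eulerCoeff (-lam) v v₁ x -
      eulerCoeff (-lam) u u₁ x * eulerCoeff lam v v₁ x =
      2 * Complex.I * lam * (u x * v₁ x - u₁ x * v x) := by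
  have h1 := eulerSol_mul_neg (lam := lam) hx
  have hx0 : (x : ℂ) ≠ 0 := by exact_mod_cast hx.ne'
  have h2 := eulerSol_ne_zero (lam := lam) hx
  have h3 := eulerSol_ne_zero (lam := -lam) hx
  rw [eulerCoeff, eulerCoeff, eulerCoeff, eulerCoeff, div_mul_div_comm, div_mul_div_comm,
    mul_comm (eulerSol (-lam) x), h1]
  field_simp
  push_cast
  ring

end Conversion

section FundamentalSystem

variable {lam A : ℝ} {q q₀ : ℝ → ℂ} {Γ : ℝ → ℝ} {S10 S20 S11 : ℝ → ℂ → ℂ}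

/-- Normalized solutions are `O(|μ|^(-1/2) exp(|Re μ| x))`. -/
lemma exists_norm_sq_le (hlam : lam ≠ 0) (hΓ : IsWeightPrimitive A q₀ Γ) {x : ℝ}
    (hx : x ∈ Set.Ioo 0 A) :
    ∃ C > (0 : ℝ), ∀ (μ : ℂ) (u u₁ : ℝ → ℂ), IsEulerSol lam A q₀ μ u u₁ →
      IsNormalizedAtZero lam u → 1 ≤ ‖μ‖ * x →
        ‖μ‖ * ‖u x‖ ^ 2 ≤ C * Real.exp (2 * |μ.re| * x) := by
  obtain ⟨C, hC, h⟩ := exists_waveEnergy_le hlam hΓ (Γ x)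
  refine ⟨C, hC, fun μ u u₁ hu hn hμ => ?_⟩
  have h1 := h μ u u₁ hu hn x hx le_rfl hμ
  have hμ0 : 0 < ‖μ‖ := by
    by_contra! h0
    nlinarith [hx.1]
  rw [waveEnergy_eq] at h1
  refine le_of_mul_le_mul_left ?_ hμ0
  nlinarith [sq_nonneg ‖u₁ x‖, sq_nonneg (‖μ‖ * ‖u x‖)]

namespace IsNormalizedFS

lemma isNormalizedAtZero_S10 (hS : IsNormalizedFS lam A q S10 S20 S11) (μ : ℂ) :
    IsNormalizedAtZero lam (fun x => S10 x μ) :=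
  isNormalizedAtZero_iff.2 (hS.2.2 μ).1

lemma isNormalizedAtZero_S20 (hS : IsNormalizedFS lam A q S10 S20 S11) (μ : ℂ) :
    IsNormalizedAtZero (-lam) (fun x => 2 * Complex.I * lam * S20 x μ) := by
  rw [isNormalizedAtZero_iff]
  simpa [sub_eq_add_neg] using (hS.2.2 μ).2.1

lemma isEulerSol_S20 (hS : IsNormalizedFS lam A q S10 S20 S11)
    (hq : ∀ x ∈ Set.Ioo (0 : ℝ) A, q x = (-(lam : ℂ) ^ 2 - 1/4) / (x : ℂ) ^ 2 + q₀ x) (μ : ℂ) :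
    IsEulerSol (-lam) A q₀ μ (fun x => 2 * Complex.I * lam * S20 x μ)
      (fun x => 2 * Complex.I * lam * deriv (fun x => S20 x μ) x) :=
  IsEulerSol.neg fun t ht =>
    have h := (hS.1 μ).2.1.isEulerSol hq t ht
    ⟨h.1.const_mul _, (h.2.const_mul _).congr_deriv (by ring)⟩

lemma wronskian_eq_one (hlam : lam ≠ 0) (hq : IsAdmissible lam A q)
    (hS : IsNormalizedFS lam A q S10 S20 S11) (μ : ℂ) {x : ℝ} (hx : x ∈ Set.Ioo 0 A) :
    S10 x μ * deriv (fun x => S20 x μ) x - deriv (fun x => S10 x μ) x * S20 x μ = 1 := by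
  have hA : 0 < A := hx.1.trans hx.2
  obtain ⟨q₀, Γ, hq₀, hΓ⟩ := hq.exists_left
  obtain ⟨h1, h2, -⟩ := hS.1 μ
  have hl : 2 * Complex.I * (lam : ℂ) ≠ 0 := by simpa using hlam
  have e1 := h1.isEulerSol hq₀
  have e2 := hS.isEulerSol_S20 hq₀ μ
  obtain ⟨a1, b1⟩ := e1.tendsto_eulerCoeff hlam hA hΓ (hS.isNormalizedAtZero_S10 μ)
  obtain ⟨b2, a2⟩ := e2.tendsto_eulerCoeff (neg_ne_zero.2 hlam) hA hΓ
    (hS.isNormalizedAtZero_S20 μ)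
  rw [neg_neg] at a2
  have hlim := (a1.mul b2).sub (b1.mul a2)
  have hconst : Tendsto (fun _ : ℝ => (2 * Complex.I * (lam : ℂ)) ^ 2 *
      (S10 x μ * deriv (fun x => S20 x μ) x - deriv (fun x => S10 x μ) x * S20 x μ))
      (𝓝[>] 0) (𝓝 ((2 * Complex.I * (lam : ℂ)) ^ 2)) := by
    have hval : (0 : ℂ) * 0 - -(2 * Complex.I * lam) * -(2 * Complex.I * ((-lam : ℝ) : ℂ)) =
        (2 * Complex.I * (lam : ℂ)) ^ 2 := by push_cast; ring
    rw [hval] at hlim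
    refine hlim.congr' ?_
    filter_upwards [Ioo_mem_nhdsGT hA] with y hy
    have hw := h1.wronskian_eq h2 hx hy
    rw [eulerCoeff_mul_sub _ _ _ _ hy.1, hw]
    ring
  have := tendsto_nhds_unique tendsto_const_nhds hconst
  exact mul_left_cancel₀ (pow_ne_zero 2 hl) (this.trans (mul_one _).symm)

lemma S11_eq (hlam : lam ≠ 0) (hA : 0 < A) (hq : IsAdmissible lam A q)
    (hS : IsNormalizedFS lam A q S10 S20 S11) (μ : ℂ) {x : ℝ} (hx : x ∈ Set.Ioo 0 A) :
    S11 x μ = deltaFun A S20 S11 μ * S10 x μ - charFun A S10 S11 μ * S20 x μ := by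
  obtain ⟨h1, h2, h3⟩ := hS.1 μ
  have hm : A / 2 ∈ Set.Ioo 0 A := ⟨by linarith, by linarith⟩
  have hw := hS.wronskian_eq_one hlam hq μ hx
  have hδ := h3.wronskian_eq h2 hm hx
  have hΔ := h3.wronskian_eq h1 hm hx
  rw [deltaFun, _root_.charFun, hδ, hΔ]
  linear_combination -S11 x μ * hw

lemma exists_norm_S10_sq_le (hlam : lam ≠ 0) (hq : IsAdmissible lam A q)
    (hS : IsNormalizedFS lam A q S10 S20 S11) {x : ℝ} (hx : x ∈ Set.Ioo 0 A) :
    ∃ C > (0 : ℝ), ∀ μ : ℂ, 1 ≤ ‖μ‖ * x →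
      ‖μ‖ * ‖S10 x μ‖ ^ 2 ≤ C * Real.exp (2 * |μ.re| * x) := by
  obtain ⟨q₀, Γ, hq₀, hΓ⟩ := hq.exists_left
  obtain ⟨C, hC, h⟩ := exists_norm_sq_le hlam hΓ hx
  exact ⟨C, hC, fun μ => h μ _ _ ((hS.1 μ).1.isEulerSol hq₀) (hS.isNormalizedAtZero_S10 μ)⟩

lemma exists_norm_S20_sq_le (hlam : lam ≠ 0) (hq : IsAdmissible lam A q)
    (hS : IsNormalizedFS lam A q S10 S20 S11) {x : ℝ} (hx : x ∈ Set.Ioo 0 A) :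
    ∃ C > (0 : ℝ), ∀ μ : ℂ, 1 ≤ ‖μ‖ * x →
      ‖μ‖ * ‖S20 x μ‖ ^ 2 ≤ C * Real.exp (2 * |μ.re| * x) := by
  obtain ⟨q₀, Γ, hq₀, hΓ⟩ := hq.exists_left
  obtain ⟨C, hC, h⟩ := exists_norm_sq_le (neg_ne_zero.2 hlam) hΓ hx
  refine ⟨C / (2 * |lam|) ^ 2, by positivity, fun μ hμ => ?_⟩
  have h1 := h μ _ _ (hS.isEulerSol_S20 hq₀ μ) (hS.isNormalizedAtZero_S20 μ) hμ
  have h2 : ‖2 * Complex.I * (lam : ℂ)‖ = 2 * |lam| := by simp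
  rw [norm_mul, h2, mul_pow] at h1
  rw [div_mul_eq_mul_div, le_div_iff₀ (by positivity)]
  linarith

lemma exists_norm_S11_sq_le (hlam : lam ≠ 0) (hq : IsAdmissible lam A q)
    (hS : IsNormalizedFS lam A q S10 S20 S11) {x : ℝ} (hx : x ∈ Set.Ioo 0 A) :
    ∃ C > (0 : ℝ), ∀ μ : ℂ, 1 ≤ ‖μ‖ * (A - x) →
      ‖μ‖ * ‖S11 x μ‖ ^ 2 ≤ C * Real.exp (2 * |μ.re| * (A - x)) := by
  obtain ⟨q₁, Γ, hq₁, hΓ⟩ := hq.exists_right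
  obtain ⟨C, hC, h⟩ := exists_norm_sq_le hlam hΓ (sub_mem_Ioo_zero hx)
  refine ⟨C, hC, fun μ hμ => ?_⟩
  have := h μ _ _ ((hS.1 μ).2.2.isEulerSol_reflect hq₁)
    (isNormalizedAtZero_reflect (hS.2.2 μ).2.2) hμ
  simpa using this

lemma exists_le_norm_charFun (hlam : lam ≠ 0) (hA : 0 < A) (hq : IsAdmissible lam A q)
    (hS : IsNormalizedFS lam A q S10 S20 S11) :
    ∃ c > (0 : ℝ), ∃ R > (0 : ℝ), ∀ r : ℝ, r ≥ R →
      c * Real.exp (r * A) ≤ ‖charFun A S10 S11 r‖ := by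
  have hm : A / 2 ∈ Set.Ioo 0 A := ⟨by linarith, by linarith⟩
  obtain ⟨q₀, Γ₀, hq₀, hΓ₀⟩ := hq.exists_left
  obtain ⟨q₁, Γ₁, hq₁, hΓ₁⟩ := hq.exists_right
  obtain ⟨c₀, hc₀, R₀, hR₀, h₀⟩ := exists_le_waveComponent hlam hΓ₀ hm
  obtain ⟨c₁, hc₁, R₁, hR₁, h₁⟩ := exists_le_waveComponent hlam hΓ₁ hm
  refine ⟨3 / 8 * √(c₀ * c₁), by positivity, max R₀ R₁, lt_max_of_lt_left hR₀,
    fun r hr => ?_⟩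
  have hr0 : 0 < r := hR₀.trans_le ((le_max_left _ _).trans hr)
  obtain ⟨a1, a2⟩ := h₀ r ((le_max_left _ _).trans hr) _ _ ((hS.1 r).1.isEulerSol hq₀)
    (hS.isNormalizedAtZero_S10 r)
  obtain ⟨b1, b2⟩ := h₁ r ((le_max_right _ _).trans hr) _ _
    ((hS.1 r).2.2.isEulerSol_reflect hq₁) (isNormalizedAtZero_reflect (hS.2.2 r).2.2)
  set s := fun x => S10 x r
  set s₁ := deriv s
  set f := fun t => S11 (A - t) r
  set f₁ := fun t => -deriv (fun x => S11 x r) (A - t)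
  have hW : 2 * r * charFun A S10 S11 r =
      waveComponent r f f₁ (A / 2) * waveComponent r s s₁ (A / 2) -
      waveComponent (-r) f f₁ (A / 2) * waveComponent (-r) s s₁ (A / 2) := by
    simp only [_root_.charFun, waveComponent, f, f₁, sub_half]
    ring
  set P := ‖waveComponent r s s₁ (A / 2)‖
  set Q := ‖waveComponent r f f₁ (A / 2)‖
  have hP : 0 ≤ P := norm_nonneg _
  have hQ : 0 ≤ Q := norm_nonneg _
  have h2 : 3 / 4 * (Q * P) ≤ 2 * r * ‖charFun A S10 S11 r‖ := by
    have h3 : ‖2 * (r : ℂ) * charFun A S10 S11 r‖ = 2 * r * ‖charFun A S10 S11 r‖ := by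
      simp [abs_of_pos hr0]
    rw [← h3, hW]
    refine le_trans ?_ (norm_sub_norm_le _ _)
    rw [norm_mul, norm_mul]
    have : ‖waveComponent (-r) f f₁ (A / 2)‖ * ‖waveComponent (-r) s s₁ (A / 2)‖ ≤
        (Q / 2) * (P / 2) := by gcongr
    linarith
  have h3 : √(c₀ * c₁) * r * Real.exp (r * A) ≤ Q * P := by
    refine le_of_sq_le_sq ?_ (by positivity)
    have h4 : 2 * r * (A / 2) = r * A := by ring
    rw [h4] at a1 b1
    have h5 := mul_le_mul b1 a1 (by positivity) (by positivity)
    rw [mul_pow, mul_pow, mul_pow, Real.sq_sqrt (by positivity)]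
    refine le_trans (le_of_eq ?_) h5
    ring
  have h6 : 0 < 2 * r := by positivity
  refine le_of_mul_le_mul_left ?_ h6
  linarith

end IsNormalizedFS

end FundamentalSystem

section Entire

/-- An even entire function of finite exponential type which is bounded along the positive real
axis and decays along the positive imaginary axis vanishes. -/
lemma eq_zero_of_even_of_bounded {f : ℂ → ℂ} (hf : Differentiable ℂ f)
    (heven : ∀ z, f z = f (-z)) {B M : ℝ}
    (hexp : ∀ᶠ z in Bornology.cobounded ℂ, ‖f z‖ ≤ M * Real.exp (B * ‖z‖))
    (hre : IsBoundedUnder (· ≤ ·) atTop fun r : ℝ => ‖f r‖)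
    (him : Tendsto (fun y : ℝ => f (y * Complex.I)) atTop (𝓝 0)) (z : ℂ) : f z = 0 := by
  obtain ⟨C, hC⟩ : ∃ C, ∀ y : ℝ, ‖f (y * Complex.I)‖ ≤ C := by
    obtain ⟨Y, hY⟩ := eventually_atTop.1 (him.norm.eventually_le_const
      (show ‖(0 : ℂ)‖ < 1 by simp))
    have hcont : Continuous fun y : ℝ => f (y * Complex.I) := by
      have := hf.continuous
      fun_prop
    obtain ⟨C, hC⟩ := (isCompact_Icc (a := 0) (b := Y)).exists_bound_of_continuousOn
      hcont.continuousOn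
    have hpos : ∀ y : ℝ, 0 ≤ y → ‖f (y * Complex.I)‖ ≤ max 1 C := fun y hy => by
      rcases le_total y Y with h | h
      · exact (hC y ⟨hy, h⟩).trans (le_max_right _ _)
      · exact (hY y h).trans (le_max_left _ _)
    refine ⟨max 1 C, fun y => ?_⟩
    rcases le_total 0 y with h | h
    · exact hpos y h
    · have := hpos (-y) (neg_nonneg.2 h)
      rwa [Complex.ofReal_neg, neg_mul, ← heven] at this
  have hright : ∀ w : ℂ, 0 ≤ w.re → ‖f w‖ ≤ C := fun w hw => by
    refine PhragmenLindelof.right_half_plane_of_bounded_on_real hf.diffContOnCl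
      ⟨1, one_lt_two, B, ?_⟩ hre hC hw
    refine (Asymptotics.IsBigO.of_bound M ?_).mono inf_le_left
    filter_upwards [hexp] with w hw
    rwa [Real.rpow_one, Real.norm_of_nonneg (Real.exp_pos _).le]
  have hb : Bornology.IsBounded (Set.range f) := by
    refine isBounded_iff_forall_norm_le.2 ⟨C, ?_⟩
    rintro _ ⟨w, rfl⟩
    rcases le_total 0 w.re with h | h
    · exact hright w h
    · rw [heven]
      exact hright (-w) (by simpa using h)
  have hconst : Tendsto (fun _ : ℝ => f z) atTop (𝓝 0) :=
    him.congr fun y => hf.apply_eq_apply_of_bounded hb _ _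
  exact tendsto_nhds_unique tendsto_const_nhds hconst

lemma mul_mul_le_of_mul_sq_le {ρ a b C D X Y : ℝ} (hC : 0 ≤ C) (hD : 0 ≤ D)
    (hρ : 0 ≤ ρ) (ha : ρ * a ^ 2 ≤ C * Real.exp (2 * X)) (hb : ρ * b ^ 2 ≤ D * Real.exp (2 * Y)) :
    ρ * (a * b) ≤ √(C * D) * Real.exp (X + Y) := by
  refine le_of_sq_le_sq ?_ (by positivity)
  calc (ρ * (a * b)) ^ 2 = (ρ * a ^ 2) * (ρ * b ^ 2) := by ring
    _ ≤ (C * Real.exp (2 * X)) * (D * Real.exp (2 * Y)) := by gcongr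
    _ = (√(C * D) * Real.exp (X + Y)) ^ 2 := by
      rw [mul_pow, Real.sq_sqrt (by positivity), ← Real.exp_nat_mul, mul_mul_mul_comm,
        ← Real.exp_add]
      push_cast
      ring_nf

end Entire

section Comparison

variable {lam A : ℝ} {q q' : ℝ → ℂ} {S10 S20 S11 T10 T20 T11 : ℝ → ℂ → ℂ}

lemma IsNormalizedFS.cross_eq_zero (hlam : lam ≠ 0) (hq : IsAdmissible lam A q)
    (hq' : IsAdmissible lam A q') (hS : IsNormalizedFS lam A q S10 S20 S11)
    (hT : IsNormalizedFS lam A q' T10 T20 T11)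
    (h : ∀ μ : ℂ, deltaFun A S20 S11 μ * _root_.charFun A T10 T11 μ =
      deltaFun A T20 T11 μ * _root_.charFun A S10 S11 μ) {x : ℝ} (hx : x ∈ Set.Ioo 0 A) (μ : ℂ) :
    S10 x μ * T20 x μ - S20 x μ * T10 x μ = 0 := by
  have hA : 0 < A := hx.1.trans hx.2
  have hx' := sub_mem_Ioo_zero hx
  obtain ⟨C₁, hC₁, s1⟩ := hS.exists_norm_S10_sq_le hlam hq hx
  obtain ⟨C₂, hC₂, s2⟩ := hS.exists_norm_S20_sq_le hlam hq hx
  obtain ⟨C₃, hC₃, s3⟩ := hS.exists_norm_S11_sq_le hlam hq hx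
  obtain ⟨D₁, hD₁, t1⟩ := hT.exists_norm_S10_sq_le hlam hq' hx
  obtain ⟨D₂, hD₂, t2⟩ := hT.exists_norm_S20_sq_le hlam hq' hx
  obtain ⟨D₃, hD₃, t3⟩ := hT.exists_norm_S11_sq_le hlam hq' hx
  obtain ⟨⟨d1, e1⟩, ⟨d2, e2⟩, -⟩ := hS.2.1 x hx
  obtain ⟨⟨d1', e1'⟩, ⟨d2', e2'⟩, -⟩ := hT.2.1 x hx
  have hgrow : ∀ μ : ℂ, 1 ≤ ‖μ‖ * x → ‖μ‖ * ‖S10 x μ * T20 x μ - S20 x μ * T10 x μ‖ ≤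
      (√(C₁ * D₂) + √(C₂ * D₁)) * Real.exp (|μ.re| * x + |μ.re| * x) := fun μ hμ => by
    have h1 := mul_mul_le_of_mul_sq_le (X := |μ.re| * x) (Y := |μ.re| * x) hC₁.le hD₂.le
      (norm_nonneg μ) (by simpa [mul_assoc] using s1 μ hμ) (by simpa [mul_assoc] using t2 μ hμ)
    have h2 := mul_mul_le_of_mul_sq_le (X := |μ.re| * x) (Y := |μ.re| * x) hC₂.le hD₁.le
      (norm_nonneg μ) (by simpa [mul_assoc] using s2 μ hμ) (by simpa [mul_assoc] using t1 μ hμ)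
    have h3 := norm_sub_le (S10 x μ * T20 x μ) (S20 x μ * T10 x μ)
    rw [norm_mul, norm_mul] at h3
    have h4 := mul_le_mul_of_nonneg_left h3 (norm_nonneg μ)
    linarith
  set M := √(C₁ * D₂) + √(C₂ * D₁)
  have hM : 0 ≤ M := by positivity
  refine eq_zero_of_even_of_bounded (f := fun μ => S10 x μ * T20 x μ - S20 x μ * T10 x μ)
    (B := 2 * x) (M := M) ((d1.mul d2').sub (d2.mul d1'))
    (fun z => by rw [← e1, ← e2, ← e1', ← e2']) ?_ ?_ ?_ μ
  · filter_upwards [tendsto_norm_cobounded_atTop.eventually_ge_atTop (max 1 x⁻¹)] with w hw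
    have h1 : 1 ≤ ‖w‖ := (le_max_left _ _).trans hw
    have h2 : 1 ≤ ‖w‖ * x := (inv_le_iff_one_le_mul₀ hx.1).1 ((le_max_right _ _).trans hw)
    calc _ ≤ ‖w‖ * ‖S10 x w * T20 x w - S20 x w * T10 x w‖ :=
          le_mul_of_one_le_left (norm_nonneg _) h1
      _ ≤ M * Real.exp (|w.re| * x + |w.re| * x) := hgrow w h2
      _ ≤ M * Real.exp (2 * x * ‖w‖) := by
        have h3 := mul_le_mul_of_nonneg_left (Complex.abs_re_le_norm w) hx.1.le
        gcongr
        linarith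
  · obtain ⟨c, hc, R, hR, hΔ⟩ := hS.exists_le_norm_charFun hlam hA hq
    obtain ⟨c', hc', R', hR', hΔ'⟩ := hT.exists_le_norm_charFun hlam hA hq'
    refine isBoundedUnder_of_eventually_le (a := √(D₁ * C₃) / c + √(C₁ * D₃) / c') ?_
    filter_upwards [eventually_ge_atTop R, eventually_ge_atTop R', eventually_ge_atTop 1,
      eventually_ge_atTop x⁻¹, eventually_ge_atTop (A - x)⁻¹] with r h1 h2 h3 h4 h5
    have hr : ‖(r : ℂ)‖ = r := by rw [Complex.norm_real, Real.norm_of_nonneg (by linarith)]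
    have h4' : 1 ≤ ‖(r : ℂ)‖ * x := by
      rw [hr]; exact (inv_le_iff_one_le_mul₀ hx.1).1 h4
    have h5' : 1 ≤ ‖(r : ℂ)‖ * (A - x) := by
      rw [hr]; exact (inv_le_iff_one_le_mul₀ hx'.1).1 h5
    have hid : _root_.charFun A S10 S11 r * _root_.charFun A T10 T11 r *
        (S10 x r * T20 x r - S20 x r * T10 x r) =
        _root_.charFun A T10 T11 r * (T10 x r * S11 x r) -
          _root_.charFun A S10 S11 r * (S10 x r * T11 x r) := by
      rw [hS.S11_eq hlam hA hq r hx, hT.S11_eq hlam hA hq' r hx]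
      linear_combination -(S10 x r * T10 x r) * h r
    have habs : |r| = r := abs_of_pos (by linarith)
    have k1 := mul_mul_le_of_mul_sq_le (X := r * x) (Y := r * (A - x)) hD₁.le hC₃.le
      (norm_nonneg (r : ℂ)) (by simpa [mul_assoc, habs] using t1 r h4')
      (by simpa [mul_assoc, habs] using s3 r h5')
    have k2 := mul_mul_le_of_mul_sq_le (X := r * x) (Y := r * (A - x)) hC₁.le hD₃.le
      (norm_nonneg (r : ℂ)) (by simpa [mul_assoc, habs] using s1 r h4')
      (by simpa [mul_assoc, habs] using t3 r h5')
    rw [hr, ← mul_add, add_sub_cancel] at k1 k2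
    have l1 := hΔ r h1
    have l2 := hΔ' r h2
    have hnorm := congrArg norm hid
    rw [norm_mul, norm_mul] at hnorm
    have hle := hnorm.le.trans (norm_sub_le _ _)
    rw [norm_mul, norm_mul, norm_mul, norm_mul] at hle
    set a := ‖_root_.charFun A S10 S11 r‖
    set b := ‖_root_.charFun A T10 T11 r‖
    set E := Real.exp (r * A)
    have hE : 0 < E := Real.exp_pos _
    have ha : 0 < a := (mul_pos hc hE).trans_le l1
    have hb : 0 < b := (mul_pos hc' hE).trans_le l2
    refine le_of_mul_le_mul_left (hle.trans ?_) (mul_pos ha hb)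
    have m1 : ‖T10 x r‖ * ‖S11 x r‖ ≤ √(D₁ * C₃) / c * a := by
      calc _ ≤ r * (‖T10 x r‖ * ‖S11 x r‖) := le_mul_of_one_le_left (by positivity) h3
        _ ≤ √(D₁ * C₃) * E := k1
        _ = √(D₁ * C₃) / c * (c * E) := by field_simp
        _ ≤ _ := by gcongr
    have m2 : ‖S10 x r‖ * ‖T11 x r‖ ≤ √(C₁ * D₃) / c' * b := by
      calc _ ≤ r * (‖S10 x r‖ * ‖T11 x r‖) := le_mul_of_one_le_left (by positivity) h3
        _ ≤ √(C₁ * D₃) * E := k2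
        _ = √(C₁ * D₃) / c' * (c' * E) := by field_simp
        _ ≤ _ := by gcongr
    calc _ ≤ b * (√(D₁ * C₃) / c * a) + a * (√(C₁ * D₃) / c' * b) := by gcongr
      _ = _ := by ring
  · have h1 : Tendsto (fun y : ℝ => M / y) atTop (𝓝 0) := tendsto_const_nhds.div_atTop tendsto_id
    refine squeeze_zero_norm' ?_ h1
    filter_upwards [eventually_gt_atTop 0, eventually_ge_atTop x⁻¹] with y hy hyx
    have hn : ‖(y : ℂ) * Complex.I‖ = y := by simp [abs_of_pos hy]
    have h2 := hgrow (y * Complex.I) (by rw [hn]; exact (inv_le_iff_one_le_mul₀ hx.1).1 hyx)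
    rw [hn] at h2
    rw [le_div_iff₀ hy, mul_comm]
    simpa using h2

/-- Two second-order equations whose normalized bases are proportional have the same potential. -/
lemma SolvesRadialODE.potential_eq {μ : ℂ} {s₁ s₂ t₁ t₂ : ℝ → ℂ}
    (hs₁ : SolvesRadialODE A q μ s₁) (hs₂ : SolvesRadialODE A q μ s₂)
    (ht₁ : SolvesRadialODE A q' μ t₁) (ht₂ : SolvesRadialODE A q' μ t₂)
    (hs : ∀ x ∈ Set.Ioo 0 A, s₁ x * deriv s₂ x - deriv s₁ x * s₂ x = 1)
    (ht : ∀ x ∈ Set.Ioo 0 A, t₁ x * deriv t₂ x - deriv t₁ x * t₂ x = 1)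
    (hst : ∀ x ∈ Set.Ioo 0 A, s₁ x * t₂ x - s₂ x * t₁ x = 0) :
    ∀ x ∈ Set.Ioo 0 A, q x = q' x := by
  set k : ℝ → ℂ := fun x => t₁ x * deriv s₂ x - t₂ x * deriv s₁ x with hk
  have hk₁ : ∀ x ∈ Set.Ioo 0 A, t₁ x = k x * s₁ x := fun x hx => by
    simp only [hk]
    linear_combination -t₁ x * hs x hx + deriv s₁ x * hst x hx
  have hk₂ : ∀ x ∈ Set.Ioo 0 A, t₂ x = k x * s₂ x := fun x hx => by
    simp only [hk]
    linear_combination -t₂ x * hs x hx + deriv s₂ x * hst x hx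
  have hkd : ∀ x ∈ Set.Ioo 0 A, HasDerivAt k (deriv k x) x := fun x hx =>
    (((ht₁ x hx).1.mul (hs₂ x hx).2.1).sub ((ht₂ x hx).1.mul (hs₁ x hx).2.1)).hasDerivAt
  have hder : ∀ {t s : ℝ → ℂ}, (∀ x ∈ Set.Ioo 0 A, t x = k x * s x) →
      (∀ x ∈ Set.Ioo 0 A, DifferentiableAt ℝ s x) →
      ∀ x ∈ Set.Ioo 0 A, deriv t x = deriv k x * s x + k x * deriv s x := by
    intro t s hts hds x hx
    have hev : t =ᶠ[𝓝 x] fun y => k y * s y := by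
      filter_upwards [isOpen_Ioo.mem_nhds hx] with y hy using hts y hy
    rw [hev.deriv_eq]
    exact ((hkd x hx).mul (hds x hx).hasDerivAt).deriv
  have hd₁ := hder hk₁ fun x hx => (hs₁ x hx).1
  have hd₂ := hder hk₂ fun x hx => (hs₂ x hx).1
  have hsq : ∀ x ∈ Set.Ioo 0 A, k x * k x = 1 := fun x hx => by
    have h1 := ht x hx
    rw [hd₁ x hx, hd₂ x hx, hk₁ x hx, hk₂ x hx] at h1
    linear_combination h1 - k x * k x * hs x hx
  have hk0 : ∀ x ∈ Set.Ioo 0 A, deriv k x = 0 := fun x hx => by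
    have h1 := (hkd x hx).mul (hkd x hx)
    have hev : (fun y => k y * k y) =ᶠ[𝓝 x] fun _ => 1 := by
      filter_upwards [isOpen_Ioo.mem_nhds hx] with y hy using hsq y hy
    have h2 := h1.unique ((hasDerivAt_const x (1 : ℂ)).congr_of_eventuallyEq hev)
    linear_combination k x / 2 * h2 - deriv k x * hsq x hx
  have hd₁' : ∀ x ∈ Set.Ioo 0 A, deriv t₁ x = k x * deriv s₁ x := fun x hx => by
    rw [hd₁ x hx, hk0 x hx, zero_mul, zero_add]
  have hd₂' : ∀ x ∈ Set.Ioo 0 A, deriv t₂ x = k x * deriv s₂ x := fun x hx => by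
    rw [hd₂ x hx, hk0 x hx, zero_mul, zero_add]
  intro x hx
  have h₁ := hder hd₁' (fun x hx => (hs₁ x hx).2.1) x hx
  have h₂ := hder hd₂' (fun x hx => (hs₂ x hx).2.1) x hx
  rw [hk0 x hx, zero_mul, zero_add, (ht₁.hasDerivAt_deriv hx).deriv,
    (hs₁.hasDerivAt_deriv hx).deriv, hk₁ x hx] at h₁
  rw [hk0 x hx, zero_mul, zero_add, (ht₂.hasDerivAt_deriv hx).deriv,
    (hs₂.hasDerivAt_deriv hx).deriv, hk₂ x hx] at h₂
  have hsqx := hsq x hx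
  have e₁ : (q x - q' x) * s₁ x = 0 := by
    linear_combination -k x * h₁ - (q x - q' x) * s₁ x * hsqx
  have e₂ : (q x - q' x) * s₂ x = 0 := by
    linear_combination -k x * h₂ - (q x - q' x) * s₂ x * hsqx
  linear_combination deriv s₂ x * e₁ - deriv s₁ x * e₂ - (q x - q' x) * hs x hx

end Comparison

/-- Local Borg–Marchenko theorem: if the generalized Weyl–Titchmarsh functions
`M = −δ/Δ` and `M̃ = −δ̃/Δ̃` of two admissible potentials coincide (equivalently,
`δΔ̃ = δ̃Δ` on all of `ℂ`), then the potentials coincide on `(0,A)`. -/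
theorem stmt15 (lam A : ℝ) (hlam : lam ≠ 0) (hA : 0 < A)
    (q q' : ℝ → ℂ) (S10 S20 S11 T10 T20 T11 : ℝ → ℂ → ℂ)
    (hq : IsAdmissible lam A q) (hq' : IsAdmissible lam A q')
    (hS : IsNormalizedFS lam A q S10 S20 S11)
    (hT : IsNormalizedFS lam A q' T10 T20 T11)
    (h : ∀ μ : ℂ, deltaFun A S20 S11 μ * charFun A T10 T11 μ =
      deltaFun A T20 T11 μ * charFun A S10 S11 μ) :
    ∀ x ∈ Set.Ioo (0 : ℝ) A, q x = q' x := by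
  intro x hx
  exact (hS.1 0).1.potential_eq (hS.1 0).2.1 (hT.1 0).1 (hT.1 0).2.1
    (fun y hy => hS.wronskian_eq_one hlam hq 0 hy) (fun y hy => hT.wronskian_eq_one hlam hq' 0 hy)
    (fun y hy => hS.cross_eq_zero hlam hq hq' hT h hy 0) x hx
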